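/- arXiv:2507.17167 — 2 statements merged into one kernel-verified Lean document; each statement's English description precedes it below -/
import Mathlib

section
/- Let ℓ be a positive integer and φ : ℕ → [2, ∞) any function. If the series Σ_{n≥1} (log φ(n))^{ℓ−1} / φ(n) converges, then the Lebesgue measure of E_ℓ(φ) is 0; if this series diverges, then the Lebesgue measure of E_ℓ(φ) is 1. -/
open MeasureTheory Filter Set

/-- The Gauss map `T(x) = 1/x - ⌊1/x⌋` (with `T 0 = 0`). -/
noncomputable def gaussMap (x : ℝ) : ℝ := if x = 0 then 0 else Int.fract x⁻¹

/-- `cfA x n` is the `n`-th partial quotient `a_n(x) = ⌊1 / T^{n-1}(x)⌋` (for `n ≥ 1`). -/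
noncomputable def cfA (x : ℝ) (n : ℕ) : ℕ := ⌊(gaussMap^[n - 1] x)⁻¹⌋₊

/-- `Eℓ ℓ φ` is the set `E_ℓ(φ)` of irrational `x ∈ [0,1)` such that
`a_n(x) ⋯ a_{n+ℓ-1}(x) ≥ φ(n)` for infinitely many `n ∈ ℕ`. -/
noncomputable def Eℓ (ℓ : ℕ) (φ : ℕ → ℝ) : Set ℝ :=
  {x | x ∈ Set.Ico (0 : ℝ) 1 ∧ Irrational x ∧
    {n : ℕ | 1 ≤ n ∧ φ n ≤ ∏ i ∈ Finset.range ℓ, (cfA x (n + i) : ℝ)}.Infinite}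

/-- Lebesgue measure on the open unit interval. -/
noncomputable abbrev unitVol : Measure ℝ := volume.restrict (Ioo 0 1)

instance : IsProbabilityMeasure unitVol := ⟨by simp⟩

/-- The inverse branch `t ↦ 1 / (a + 1 + t)` of the Gauss map. -/
noncomputable def gaussBranch (a : ℕ) (t : ℝ) : ℝ := ((a : ℝ) + 1 + t)⁻¹

/-- The product of the first `ℓ` partial quotients. -/
noncomputable def cfProd (ℓ : ℕ) (x : ℝ) : ℝ := ∏ i ∈ Finset.range ℓ, (cfA x (i + 1) : ℝ)

lemma measurable_gaussMap : Measurable gaussMap :=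
  Measurable.ite (measurableSet_singleton 0) measurable_const
    (measurable_fract.comp measurable_inv)

lemma measurable_cfA (n : ℕ) : Measurable fun x => cfA x n :=
  Nat.measurable_floor.comp ((measurable_gaussMap.iterate (n - 1)).inv)

lemma measurable_cfProd (ℓ : ℕ) : Measurable (cfProd ℓ) :=
  Finset.measurable_fun_prod _ fun i _ => measurable_from_nat.comp (measurable_cfA (i + 1))

lemma cfA_iterate (x : ℝ) (m i : ℕ) : cfA (gaussMap^[m] x) (i + 1) = cfA x (m + i + 1) := by
  simp only [cfA, Nat.add_sub_cancel, ← Function.iterate_add_apply, add_comm i m]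

lemma cfProd_iterate (ℓ m : ℕ) (x : ℝ) :
    cfProd ℓ (gaussMap^[m] x) = ∏ i ∈ Finset.range ℓ, (cfA x (m + 1 + i) : ℝ) := by
  simp only [cfProd, cfA_iterate, add_right_comm]

lemma cfProd_succ (ℓ : ℕ) (x : ℝ) :
    cfProd (ℓ + 1) x = cfA x 1 * cfProd ℓ (gaussMap x) := by
  have := cfProd_iterate ℓ 1 x
  rw [Function.iterate_one] at this
  rw [this, cfProd, Finset.prod_range_succ', mul_comm]
  congr 1

lemma gaussBranch_pos (a : ℕ) {t : ℝ} (ht : t ∈ Ioo (0 : ℝ) 1) : 0 < gaussBranch a t := by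
  have := ht.1
  unfold gaussBranch
  positivity

lemma gaussBranch_mem (a : ℕ) {t : ℝ} (ht : t ∈ Ioo (0 : ℝ) 1) :
    gaussBranch a t ∈ Ioo (0 : ℝ) 1 := by
  refine ⟨gaussBranch_pos a ht, inv_lt_one_of_one_lt₀ ?_⟩
  have := ht.1
  have : (0 : ℝ) ≤ a := a.cast_nonneg
  linarith

lemma gaussMap_gaussBranch (a : ℕ) {t : ℝ} (ht : t ∈ Ioo (0 : ℝ) 1) :
    gaussMap (gaussBranch a t) = t := by
  rw [gaussMap, if_neg (gaussBranch_pos a ht).ne', gaussBranch, inv_inv,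
    show (a : ℝ) + 1 + t = ((a + 1 : ℕ) : ℝ) + t by push_cast; ring, Int.fract_natCast_add]
  exact Int.fract_eq_self.2 ⟨ht.1.le, ht.2⟩

lemma cfA_one_gaussBranch (a : ℕ) {t : ℝ} (ht : t ∈ Ioo (0 : ℝ) 1) :
    cfA (gaussBranch a t) 1 = a + 1 := by
  have h0 := ht.1
  have h1 := ht.2
  simp only [cfA, Nat.sub_self, Function.iterate_zero, id, gaussBranch, inv_inv]
  rw [Nat.floor_eq_iff (by positivity)]
  push_cast
  constructor <;> linarith

lemma cfProd_succ_gaussBranch (ℓ a : ℕ) {t : ℝ} (ht : t ∈ Ioo (0 : ℝ) 1) :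
    cfProd (ℓ + 1) (gaussBranch a t) = ((a : ℝ) + 1) * cfProd ℓ t := by
  rw [cfProd_succ, cfA_one_gaussBranch a ht, gaussMap_gaussBranch a ht]
  push_cast
  rfl

lemma hasDerivAt_gaussBranch (a : ℕ) {t : ℝ} (ht : t ∈ Ioo (0 : ℝ) 1) :
    HasDerivAt (gaussBranch a) (-(gaussBranch a t ^ 2)) t := by
  have h := ht.1
  have h2 : ((a : ℝ) + 1 + t) ≠ 0 := by positivity
  have := ((hasDerivAt_id t).const_add ((a : ℝ) + 1)).inv h2
  refine this.congr_deriv ?_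
  simp [gaussBranch, neg_div]

lemma measurable_gaussBranch (a : ℕ) : Measurable (gaussBranch a) :=
  (measurable_id.const_add _).inv

lemma injOn_gaussBranch (a : ℕ) : InjOn (gaussBranch a) (Ioo 0 1) := fun s hs t ht h => by
  rw [← gaussMap_gaussBranch a hs, h, gaussMap_gaussBranch a ht]

lemma ae_irrational : ∀ᵐ x : ℝ, Irrational x := by
  rw [ae_iff]
  exact (Set.countable_range ((↑) : ℚ → ℝ)).mono (fun x hx => by simpa [Irrational] using hx)
    |>.measure_zero _

/-- Change of variables along the inverse branches of the Gauss map. -/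
lemma lintegral_eq_tsum_gaussBranch (F : ℝ → ENNReal) :
    ∫⁻ x, F x ∂unitVol =
      ∑' a : ℕ, ∫⁻ t, ENNReal.ofReal (gaussBranch a t ^ 2) * F (gaussBranch a t) ∂unitVol := by
  have hmeas : ∀ a : ℕ, MeasurableSet (gaussBranch a '' Ioo 0 1) := fun a =>
    measurableSet_Ioo.image_of_measurable_injOn (measurable_gaussBranch a) (injOn_gaussBranch a)
  have hdisj : Pairwise (Function.onFun Disjoint fun a : ℕ => gaussBranch a '' Ioo 0 1) := by
    intro a b hab
    refine Set.disjoint_left.2 ?_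
    rintro _ ⟨s, hs, rfl⟩ ⟨t, ht, h⟩
    have := cfA_one_gaussBranch a hs
    rw [← h, cfA_one_gaussBranch b ht] at this
    exact hab (by omega)
  have hae : (Ioo (0 : ℝ) 1) =ᵐ[volume] ⋃ a : ℕ, gaussBranch a '' Ioo 0 1 := by
    filter_upwards [ae_irrational] with x hx
    refine propext ⟨fun h => ?_, fun h => ?_⟩
    · have h0 : 0 < x := h.1
      have h1 : 1 < x⁻¹ := (one_lt_inv₀ h0).2 h.2
      have h2 : 1 ≤ ⌊x⁻¹⌋₊ := Nat.one_le_floor_iff _ |>.2 h1.le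
      refine mem_iUnion.2 ⟨⌊x⁻¹⌋₊ - 1, x⁻¹ - ⌊x⁻¹⌋₊, ⟨?_, ?_⟩, ?_⟩
      · have h3 := Nat.floor_le (inv_pos.2 h0).le
        refine sub_pos.2 (lt_of_le_of_ne h3 fun h4 => ?_)
        exact (irrational_inv_iff.2 hx) ⟨(⌊x⁻¹⌋₊ : ℚ), by simpa using h4⟩
      · have := Nat.lt_floor_add_one x⁻¹
        linarith
      · rw [gaussBranch, Nat.cast_sub h2]
        push_cast
        rw [show (⌊x⁻¹⌋₊ : ℝ) - 1 + 1 + (x⁻¹ - ⌊x⁻¹⌋₊) = x⁻¹ by ring, inv_inv]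
    · obtain ⟨a, t, ht, rfl⟩ := mem_iUnion.1 h
      exact gaussBranch_mem a ht
  rw [setLIntegral_congr hae, lintegral_iUnion hmeas hdisj]
  congr 1
  ext a
  rw [lintegral_image_eq_lintegral_abs_deriv_mul measurableSet_Ioo
    (fun t ht => (hasDerivAt_gaussBranch a ht).hasDerivWithinAt) (injOn_gaussBranch a)]
  simp only [abs_neg, abs_pow, sq_abs]

/-- Nonnegative functions on `(0, 1)` with controlled distortion, a class of densities that is
stable under the transfer operators of the branches of the Gauss map. -/
structure IsGaussDensity (f : ℝ → ENNReal) : Prop where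
  measurable : Measurable f
  anti : ∀ s ∈ Ioo (0 : ℝ) 1, ∀ t ∈ Ioo (0 : ℝ) 1, s ≤ t → f t ≤ f s
  mono : ∀ s ∈ Ioo (0 : ℝ) 1, ∀ t ∈ Ioo (0 : ℝ) 1, s ≤ t →
    f s * ENNReal.ofReal ((1 + s) ^ 2) ≤ f t * ENNReal.ofReal ((1 + t) ^ 2)

namespace IsGaussDensity

lemma const (c : ENNReal) : IsGaussDensity fun _ => c where
  measurable := measurable_const
  anti _ _ _ _ _ := le_rfl
  mono s hs t ht hst := by
    have := hs.1
    gcongr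

lemma tsum {g : ℕ → ℝ → ENNReal} (hg : ∀ a, IsGaussDensity (g a)) :
    IsGaussDensity fun t => ∑' a, g a t where
  measurable := Measurable.tsum fun a => (hg a).measurable
  anti s hs t ht hst := ENNReal.tsum_le_tsum fun a => (hg a).anti s hs t ht hst
  mono s hs t ht hst := by
    rw [← ENNReal.tsum_mul_right, ← ENNReal.tsum_mul_right]
    exact ENNReal.tsum_le_tsum fun a => (hg a).mono s hs t ht hst

lemma transfer {f : ℝ → ENNReal} (hf : IsGaussDensity f) (a : ℕ) :
    IsGaussDensity fun t => ENNReal.ofReal (gaussBranch a t ^ 2) * f (gaussBranch a t) where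
  measurable := by
    have h1 := measurable_gaussBranch a
    have h2 := hf.measurable.comp h1
    exact (h1.pow_const 2).ennreal_ofReal.mul h2
  anti s hs t ht hst := by
    have hs0 := hs.1
    have ht0 := ht.1
    have hle : gaussBranch a t ≤ gaussBranch a s := by
      unfold gaussBranch; gcongr
    have key : ∀ t ∈ Ioo (0 : ℝ) 1, ENNReal.ofReal (gaussBranch a t ^ 2) =
        ENNReal.ofReal ((1 + gaussBranch a t) ^ 2) *
          ENNReal.ofReal ((gaussBranch (a + 1) t) ^ 2) := by
      intro t ht
      have ht0 := ht.1
      rw [← ENNReal.ofReal_mul (by positivity), ← mul_pow]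
      congr 2
      unfold gaussBranch
      push_cast
      field_simp
      ring
    rw [key t ht, key s hs, mul_comm, mul_comm _ (f (gaussBranch a s)), ← mul_assoc, ← mul_assoc]
    refine mul_le_mul' (hf.mono _ (gaussBranch_mem a ht) _ (gaussBranch_mem a hs) hle) ?_
    refine ENNReal.ofReal_le_ofReal (pow_le_pow_left₀ (gaussBranch_pos _ ht).le ?_ 2)
    unfold gaussBranch; gcongr
  mono s hs t ht hst := by
    have hs0 := hs.1
    have ht0 := ht.1
    have hle : gaussBranch a t ≤ gaussBranch a s := by
      unfold gaussBranch; gcongr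
    rw [mul_right_comm, mul_right_comm (ENNReal.ofReal (gaussBranch a t ^ 2)),
      ← ENNReal.ofReal_mul (by positivity),
      ← ENNReal.ofReal_mul (by positivity), ← mul_pow, ← mul_pow]
    refine mul_le_mul' (ENNReal.ofReal_le_ofReal (pow_le_pow_left₀ ?_ ?_ 2))
      (hf.anti _ (gaussBranch_mem a ht) _ (gaussBranch_mem a hs) hle)
    · have := gaussBranch_pos a hs
      positivity
    · unfold gaussBranch
      have ha : (0 : ℝ) ≤ a := a.cast_nonneg
      rw [← div_eq_inv_mul, ← div_eq_inv_mul, div_le_div_iff₀ (by positivity) (by positivity)]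
      nlinarith [mul_nonneg ha (sub_nonneg.2 hst)]

lemma le_four_mul {f : ℝ → ENNReal} (hf : IsGaussDensity f) {s t : ℝ}
    (hs : s ∈ Ioo (0 : ℝ) 1) (ht : t ∈ Ioo (0 : ℝ) 1) : f s ≤ 4 * f t := by
  rcases le_total t s with h | h
  · exact (hf.anti t ht s hs h).trans (le_mul_of_one_le_left' (by norm_num))
  · calc f s ≤ f s * ENNReal.ofReal ((1 + s) ^ 2) :=
          le_mul_of_one_le_right' (by
            rw [ENNReal.one_le_ofReal]; nlinarith [hs.1])
      _ ≤ f t * ENNReal.ofReal ((1 + t) ^ 2) := hf.mono s hs t ht h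
      _ ≤ f t * 4 := by
          gcongr
          refine ENNReal.ofReal_le_of_le_toReal ?_
          norm_num
          nlinarith [ht.1, ht.2]
      _ = 4 * f t := mul_comm _ _

lemma setLIntegral_le {f : ℝ → ENNReal} (hf : IsGaussDensity f) (B : Set ℝ) :
    ∫⁻ x in B, f x ∂unitVol ≤ 4 * unitVol B * ∫⁻ x, f x ∂unitVol := by
  have h1 : ∀ s ∈ Ioo (0 : ℝ) 1, f s ≤ 4 * ∫⁻ x, f x ∂unitVol := fun s hs => by
    rw [← lintegral_const_mul _ hf.measurable]
    calc f s = ∫⁻ _, f s ∂unitVol := by simp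
      _ ≤ _ := setLIntegral_mono' measurableSet_Ioo fun t ht => hf.le_four_mul hs ht
  calc ∫⁻ x in B, f x ∂unitVol ≤ ∫⁻ _ in B, 4 * ∫⁻ x, f x ∂unitVol ∂unitVol :=
        lintegral_mono_ae (ae_restrict_of_ae
          ((ae_restrict_iff' measurableSet_Ioo).2 (Eventually.of_forall h1)))
    _ = _ := by rw [setLIntegral_const]; ring

lemma le_setLIntegral {f : ℝ → ENNReal} (hf : IsGaussDensity f) (B : Set ℝ) :
    unitVol B / 4 * ∫⁻ x, f x ∂unitVol ≤ ∫⁻ x in B, f x ∂unitVol := by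
  have h1 : ∀ t ∈ Ioo (0 : ℝ) 1, (∫⁻ x, f x ∂unitVol) / 4 ≤ f t := fun t ht => by
    refine ENNReal.div_le_of_le_mul' ?_
    calc ∫⁻ x, f x ∂unitVol ≤ ∫⁻ _, 4 * f t ∂unitVol :=
          setLIntegral_mono' measurableSet_Ioo fun s hs => hf.le_four_mul hs ht
      _ = _ := by simp
  calc _ = ∫⁻ _ in B, (∫⁻ x, f x ∂unitVol) / 4 ∂unitVol := by
        rw [setLIntegral_const]; simp only [div_eq_mul_inv]; ring
    _ ≤ ∫⁻ x in B, f x ∂unitVol :=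
        lintegral_mono_ae (ae_restrict_of_ae
          ((ae_restrict_iff' measurableSet_Ioo).2 (Eventually.of_forall h1)))

/-- Restricting a density to a set determined by the first `ℓ` partial quotients and pushing it
forward by the `ℓ`-th iterate of the Gauss map gives a density of the same class. -/
lemma exists_pushforward (ℓ : ℕ) : ∀ (y : ℝ) {f : ℝ → ENNReal}, IsGaussDensity f →
    ∃ g, IsGaussDensity g ∧ ∀ h : ℝ → ENNReal, Measurable h →
      ∫⁻ x, {x | cfProd ℓ x < y}.indicator 1 x * f x * h (gaussMap^[ℓ] x) ∂unitVol =
        ∫⁻ x, g x * h x ∂unitVol := by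
  induction ℓ with
  | zero =>
    intro y f hf
    by_cases hy : 1 < y
    · exact ⟨f, hf, fun h _ => by simp [cfProd, hy]⟩
    · exact ⟨fun _ => 0, const 0, fun h _ => by simp [cfProd, hy]⟩
  | succ ℓ ih =>
    intro y f hf
    choose g hg hgh using fun a : ℕ => ih (y / ((a : ℝ) + 1)) (hf.transfer a)
    refine ⟨_, tsum hg, fun h hh => ?_⟩
    rw [lintegral_eq_tsum_gaussBranch]
    simp_rw [← ENNReal.tsum_mul_right]
    rw [lintegral_tsum (f := fun a x => g a x * h x)
      fun a => ((hg a).measurable.mul hh).aemeasurable]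
    congr 1
    ext a
    rw [← hgh a h hh]
    refine setLIntegral_congr_fun measurableSet_Ioo fun t ht => ?_
    have h1 : (gaussBranch a t ∈ {x | cfProd (ℓ + 1) x < y}) ↔
        t ∈ {x | cfProd ℓ x < y / ((a : ℝ) + 1)} := by
      rw [mem_ofPred_eq, mem_ofPred_eq, cfProd_succ_gaussBranch ℓ a ht,
        lt_div_iff₀ (by positivity), mul_comm]
    simp only [Function.iterate_succ_apply, gaussMap_gaussBranch a ht, indicator, h1,
      Pi.one_apply]
    ring

end IsGaussDensity

lemma measurableSet_cfProd_lt (ℓ : ℕ) (y : ℝ) : MeasurableSet {x | cfProd ℓ x < y} :=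
  measurableSet_lt (measurable_cfProd ℓ) measurable_const

lemma measurableSet_le_cfProd (ℓ : ℕ) (y : ℝ) : MeasurableSet {x | y ≤ cfProd ℓ x} :=
  measurableSet_le measurable_const (measurable_cfProd ℓ)

/-- Points whose first `M` blocks of `ℓ` partial quotients have products below the `y j`. -/
def blockAvoid (ℓ : ℕ) (y : ℕ → ℝ) (M : ℕ) : Set ℝ :=
  {x | ∀ j < M, cfProd ℓ (gaussMap^[ℓ * j] x) < y j}

lemma measurableSet_blockAvoid (ℓ : ℕ) (y : ℕ → ℝ) (M : ℕ) :
    MeasurableSet (blockAvoid ℓ y M) := by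
  have : blockAvoid ℓ y M =
      ⋂ j ∈ Finset.range M, gaussMap^[ℓ * j] ⁻¹' {x | cfProd ℓ x < y j} := by
    ext x
    simp [blockAvoid]
  rw [this]
  exact Finset.measurableSet_biInter _ fun j _ =>
    (measurable_gaussMap.iterate _) (measurableSet_cfProd_lt ℓ (y j))

lemma mem_blockAvoid_succ {ℓ : ℕ} {y : ℕ → ℝ} {M : ℕ} {x : ℝ} :
    x ∈ blockAvoid ℓ y (M + 1) ↔
      cfProd ℓ x < y 0 ∧ gaussMap^[ℓ] x ∈ blockAvoid ℓ (fun j => y (j + 1)) M := by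
  simp only [blockAvoid, mem_ofPred_eq, ← Function.iterate_add_apply]
  constructor
  · exact fun h => ⟨by simpa using h 0 (by omega), fun j hj => h (j + 1) (by omega)⟩
  · rintro ⟨h0, h⟩ (_ | j) hj
    · simpa using h0
    · exact h j (by omega)

namespace IsGaussDensity

lemma lintegral_iterate_le (n : ℕ) {B : Set ℝ} (hB : MeasurableSet B) :
    ∀ {f : ℝ → ENNReal}, IsGaussDensity f →
      ∫⁻ x, B.indicator 1 (gaussMap^[n] x) * f x ∂unitVol ≤
        4 * unitVol B * ∫⁻ x, f x ∂unitVol := by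
  induction n with
  | zero =>
    intro f hf
    refine le_trans (le_of_eq ?_) (hf.setLIntegral_le B)
    rw [← lintegral_indicator hB]
    refine lintegral_congr fun x => ?_
    by_cases hx : x ∈ B <;> simp [hx]
  | succ n ih =>
    intro f hf
    rw [lintegral_eq_tsum_gaussBranch, lintegral_eq_tsum_gaussBranch f, ← ENNReal.tsum_mul_left]
    refine ENNReal.tsum_le_tsum fun a => le_trans (le_of_eq ?_) (ih (hf.transfer a))
    refine setLIntegral_congr_fun measurableSet_Ioo fun t ht => ?_
    simp only [Function.iterate_succ_apply, gaussMap_gaussBranch a ht]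
    ring

lemma lintegral_blockAvoid_le (ℓ M : ℕ) : ∀ (y : ℕ → ℝ) {f : ℝ → ENNReal}, IsGaussDensity f →
    (1 + ∑ j ∈ Finset.range M, unitVol {x | y j ≤ cfProd ℓ x} / 4) *
      ∫⁻ x, (blockAvoid ℓ y M).indicator 1 x * f x ∂unitVol ≤ ∫⁻ x, f x ∂unitVol := by
  induction M with
  | zero => intro y f _; simp [blockAvoid]
  | succ M ih =>
    intro y f hf
    obtain ⟨g, hg, hgh⟩ := exists_pushforward ℓ (y 0) hf
    set c := unitVol {x | y 0 ≤ cfProd ℓ x} / 4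
    set S := ∑ j ∈ Finset.range M, unitVol {x | y (j + 1) ≤ cfProd ℓ x} / 4
    set B := blockAvoid ℓ (fun j => y (j + 1)) M
    have h1 : ∫⁻ x, (blockAvoid ℓ y (M + 1)).indicator 1 x * f x ∂unitVol =
        ∫⁻ x, B.indicator 1 x * g x ∂unitVol := by
      simp_rw [mul_comm _ (g _)]
      rw [← hgh (B.indicator 1) (measurable_one.indicator (measurableSet_blockAvoid ℓ _ M))]
      refine lintegral_congr fun x => ?_
      by_cases ha : cfProd ℓ x < y 0 <;> by_cases hb : gaussMap^[ℓ] x ∈ B <;>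
        simp [indicator, mem_blockAvoid_succ, ha, hb, B]
    have h2 : ∫⁻ x, g x ∂unitVol = ∫⁻ x in {x | cfProd ℓ x < y 0}, f x ∂unitVol := by
      rw [← lintegral_indicator (measurableSet_cfProd_lt ℓ (y 0))]
      have := hgh (fun _ => 1) measurable_const
      simp only [mul_one] at this
      rw [← this]
      refine lintegral_congr fun x => ?_
      by_cases ha : cfProd ℓ x < y 0 <;> simp [ha]
    have h3 : (1 + c) * ∫⁻ x in {x | cfProd ℓ x < y 0}, f x ∂unitVol ≤ ∫⁻ x, f x ∂unitVol := by
      rw [add_mul, one_mul]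
      have hc : {x | y 0 ≤ cfProd ℓ x} = {x | cfProd ℓ x < y 0}ᶜ := by
        ext x; simp
      rw [← lintegral_add_compl (μ := unitVol) f (measurableSet_cfProd_lt ℓ (y 0)), ← hc]
      refine add_le_add le_rfl ?_
      exact (mul_le_mul' le_rfl (setLIntegral_le_lintegral _ _)).trans (hf.le_setLIntegral _)
    calc _ = (1 + (S + c)) * ∫⁻ x, B.indicator 1 x * g x ∂unitVol := by
          rw [h1, Finset.sum_range_succ']
      _ ≤ (1 + c) * ((1 + S) * ∫⁻ x, B.indicator 1 x * g x ∂unitVol) := by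
          rw [← mul_assoc]
          gcongr
          calc 1 + (S + c) ≤ 1 + (S + c) + c * S := le_self_add
            _ = (1 + c) * (1 + S) := by ring
      _ ≤ (1 + c) * ∫⁻ x, g x ∂unitVol := by gcongr; exact ih _ hg
      _ ≤ _ := by rw [h2]; exact h3

end IsGaussDensity

lemma unitVol_preimage_iterate_le (n : ℕ) {B : Set ℝ} (hB : MeasurableSet B) :
    unitVol (gaussMap^[n] ⁻¹' B) ≤ 4 * unitVol B := by
  have := (IsGaussDensity.const 1).lintegral_iterate_le n hB
  simp only [mul_one, lintegral_const, measure_univ] at this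
  refine le_trans (le_of_eq ?_) this
  rw [← lintegral_indicator_one (measurable_gaussMap.iterate n hB)]
  rfl

lemma unitVol_blockAvoid_mul_le (ℓ : ℕ) (y : ℕ → ℝ) (M : ℕ) :
    (∑ j ∈ Finset.range M, unitVol {x | y j ≤ cfProd ℓ x} / 4) * unitVol (blockAvoid ℓ y M) ≤
      1 := by
  have := (IsGaussDensity.const 1).lintegral_blockAvoid_le ℓ M y
  simp only [mul_one, lintegral_const, measure_univ,
    lintegral_indicator_one (measurableSet_blockAvoid ℓ y M)] at this
  exact le_trans (by gcongr; exact le_add_self) this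

/-- If the tails of the products are not summable, almost every point has a block whose product
exceeds its threshold. -/
lemma unitVol_forall_lt_eq_zero {ℓ : ℕ} {y : ℕ → ℝ}
    (hy : ∑' j, unitVol {x | y j ≤ cfProd ℓ x} = ⊤) :
    unitVol {x | ∀ j, cfProd ℓ (gaussMap^[ℓ * j] x) < y j} = 0 := by
  set B := {x | ∀ j, cfProd ℓ (gaussMap^[ℓ * j] x) < y j}
  have h1 : (∑' j, unitVol {x | y j ≤ cfProd ℓ x} / 4) * unitVol B ≤ 1 := by
    rw [← ENNReal.tsum_mul_right, ENNReal.tsum_eq_iSup_nat]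
    refine iSup_le fun M => ?_
    rw [← Finset.sum_mul]
    refine le_trans ?_ (unitVol_blockAvoid_mul_le ℓ y M)
    gcongr
    exact fun x hx j _ => hx j
  simp_rw [div_eq_mul_inv] at h1
  rw [ENNReal.tsum_mul_right, hy, ENNReal.top_mul (by simp)] at h1
  by_contra h
  rw [ENNReal.top_mul h] at h1
  exact absurd h1 (by simp)

lemma unitVol_le_cfProd_succ (ℓ : ℕ) {y : ℝ} (hy : 0 < y) :
    unitVol {x | y ≤ cfProd (ℓ + 1) x} ≤ ENNReal.ofReal (1 / y) +
      ∑ a ∈ Finset.range ⌊y⌋₊, ENNReal.ofReal (1 / ((a : ℝ) + 1) ^ 2) *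
        unitVol {x | y / ((a : ℝ) + 1) ≤ cfProd ℓ x} := by
  have hsub : {x | y ≤ cfProd (ℓ + 1) x} ⊆
      Iio (1 / y) ∪ ({x | y ≤ cfProd (ℓ + 1) x} ∩ Ici (1 / y)) := fun x hx => by
    rcases lt_or_ge x (1 / y) with h | h
    · exact Or.inl h
    · exact Or.inr ⟨hx, h⟩
  refine (measure_mono hsub).trans ((measure_union_le _ _).trans (add_le_add ?_ ?_))
  · rw [Measure.restrict_apply measurableSet_Iio]
    calc volume (Iio (1 / y) ∩ Ioo 0 1) ≤ volume (Ioo 0 (1 / y)) :=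
          measure_mono fun x hx => ⟨hx.2.1, hx.1⟩
      _ = _ := by rw [Real.volume_Ioo, sub_zero]
  · have hsum := (tsum_eq_sum (L := SummationFilter.unconditional ℕ) (s := Finset.range ⌊y⌋₊)
        (f := fun a : ℕ => if a ∈ Finset.range ⌊y⌋₊ then ENNReal.ofReal (1 / ((a : ℝ) + 1) ^ 2) *
          unitVol {x | y / ((a : ℝ) + 1) ≤ cfProd ℓ x} else 0) (fun a ha => if_neg ha)).trans
        (Finset.sum_congr rfl fun a ha => if_pos ha)
    rw [← hsum,
      ← lintegral_indicator_one ((measurableSet_le_cfProd _ y).inter measurableSet_Ici),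
      lintegral_eq_tsum_gaussBranch]
    refine ENNReal.tsum_le_tsum fun a => ?_
    split_ifs with ha
    · rw [← lintegral_indicator_one (measurableSet_le_cfProd ℓ _),
        ← lintegral_const_mul _ (measurable_one.indicator (measurableSet_le_cfProd ℓ _))]
      refine setLIntegral_mono' measurableSet_Ioo fun t ht => ?_
      have ht0 := ht.1
      refine mul_le_mul' (ENNReal.ofReal_le_ofReal ?_) ?_
      · rw [gaussBranch, inv_pow, one_div]
        gcongr ?_⁻¹
        gcongr ?_ ^ 2
        linarith
      · have h1 : gaussBranch a t ∈ {x | y ≤ cfProd (ℓ + 1) x} ∩ Ici (1 / y) →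
            t ∈ {x | y / ((a : ℝ) + 1) ≤ cfProd ℓ x} := fun h => by
          have h2 := h.1
          rw [mem_ofPred_eq, cfProd_succ_gaussBranch ℓ a ht] at h2
          exact (div_le_iff₀' (by positivity)).2 h2
        by_cases h : gaussBranch a t ∈ {x | y ≤ cfProd (ℓ + 1) x} ∩ Ici (1 / y)
        · rw [indicator_of_mem h, indicator_of_mem (h1 h)]
          simp
        · rw [indicator_of_notMem h]
          exact zero_le
    · refine le_of_eq ?_
      refine (setLIntegral_congr_fun (g := fun _ => 0) measurableSet_Ioo fun t ht => ?_).trans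
        lintegral_zero
      have : gaussBranch a t ∉ {x | y ≤ cfProd (ℓ + 1) x} ∩ Ici (1 / y) := fun h => by
        have h1 := h.2
        have ht0 := ht.1
        have ht1 := ht.2
        rw [mem_Ici, gaussBranch, one_div, inv_le_inv₀ hy (by positivity)] at h1
        rw [Finset.mem_range, not_lt, ← Nat.lt_add_one_iff, Nat.floor_lt hy.le] at ha
        push_cast at ha
        linarith
      simp only [indicator_of_notMem this, mul_zero]

lemma le_unitVol_cfProd_succ (ℓ N : ℕ) (y : ℝ) :
    ∑ a ∈ Finset.range N, ENNReal.ofReal (1 / ((a : ℝ) + 2) ^ 2) *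
        unitVol {x | y / ((a : ℝ) + 1) ≤ cfProd ℓ x} ≤
      unitVol {x | y ≤ cfProd (ℓ + 1) x} := by
  rw [← lintegral_indicator_one (measurableSet_le_cfProd _ y), lintegral_eq_tsum_gaussBranch]
  refine (Finset.sum_le_sum fun a _ => ?_).trans (ENNReal.sum_le_tsum (Finset.range N))
  rw [← lintegral_indicator_one (measurableSet_le_cfProd ℓ _),
    ← lintegral_const_mul _ (measurable_one.indicator (measurableSet_le_cfProd ℓ _))]
  refine setLIntegral_mono' measurableSet_Ioo fun t ht => ?_
  have ht0 := ht.1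
  have ht1 := ht.2
  refine mul_le_mul' (ENNReal.ofReal_le_ofReal ?_) (le_of_eq ?_)
  · rw [gaussBranch, inv_pow, one_div]
    gcongr ?_⁻¹
    gcongr ?_ ^ 2
    linarith
  · simp only [indicator, mem_ofPred_eq, cfProd_succ_gaussBranch ℓ a ht,
      div_le_iff₀' (show (0 : ℝ) < a + 1 by positivity), Pi.one_apply]

lemma unitVol_cfProd_le (m : ℕ) : ∃ C : ℝ, 0 ≤ C ∧ ∀ y : ℝ, 1 ≤ y →
    unitVol {x | y ≤ cfProd (m + 1) x} ≤ ENNReal.ofReal (C * ((1 + Real.log y) ^ m / y)) := by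
  induction m with
  | zero =>
    refine ⟨1, zero_le_one, fun y hy => ?_⟩
    have hy0 : 0 < y := by linarith
    have hsub : {x | y ≤ cfProd (0 + 1) x} ∩ Ioo 0 1 ⊆ Icc 0 (1 / y) := fun x ⟨hx, hx1⟩ => by
      refine ⟨hx1.1.le, ?_⟩
      simp only [cfProd, cfA, mem_ofPred_eq, zero_add, Finset.range_one, Finset.prod_singleton,
        Nat.sub_self, Function.iterate_zero, id] at hx
      rw [one_div, le_inv_comm₀ hx1.1 hy0]
      exact hx.trans (Nat.floor_le (inv_pos.2 hx1.1).le)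
    rw [Measure.restrict_apply (measurableSet_le_cfProd _ y)]
    refine (measure_mono hsub).trans (le_of_eq ?_)
    rw [Real.volume_Icc, sub_zero, pow_zero, one_mul]
  | succ m ih =>
    obtain ⟨C, hC, h⟩ := ih
    refine ⟨C + 1, by positivity, fun y hy => ?_⟩
    have hy0 : 0 < y := by linarith
    have hl : 0 ≤ Real.log y := Real.log_nonneg hy
    set L := 1 + Real.log y
    have hL : 1 ≤ L := by simp only [L]; linarith
    have hterm : ∀ a ∈ Finset.range ⌊y⌋₊, ENNReal.ofReal (1 / ((a : ℝ) + 1) ^ 2) *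
        unitVol {x | y / ((a : ℝ) + 1) ≤ cfProd (m + 1) x} ≤
          ENNReal.ofReal (C * L ^ m / y * ((a : ℝ) + 1)⁻¹) := by
      intro a ha
      rw [Finset.mem_range, ← Nat.add_one_le_iff, Nat.le_floor_iff hy0.le] at ha
      push_cast at ha
      have h1 : 1 ≤ y / ((a : ℝ) + 1) := (one_le_div₀ (by positivity)).2 ha
      refine (mul_le_mul' le_rfl (h _ h1)).trans ?_
      rw [← ENNReal.ofReal_mul (by positivity)]
      refine ENNReal.ofReal_le_ofReal ?_
      have h2 : (1 + Real.log (y / ((a : ℝ) + 1))) ^ m ≤ L ^ m := by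
        have := Real.log_nonneg h1
        gcongr ?_ ^ m
        refine add_le_add le_rfl ?_
        exact Real.log_le_log (by positivity)
          (div_le_self hy0.le (by linarith [a.cast_nonneg (α := ℝ)]))
      calc _ ≤ 1 / ((a : ℝ) + 1) ^ 2 * (C * (L ^ m / (y / ((a : ℝ) + 1)))) := by gcongr
        _ = _ := by field_simp
    refine (unitVol_le_cfProd_succ (m + 1) hy0).trans ?_
    refine (add_le_add le_rfl (Finset.sum_le_sum hterm)).trans ?_
    rw [← ENNReal.ofReal_sum_of_nonneg fun a _ => by positivity,
      ← ENNReal.ofReal_add (by positivity) (Finset.sum_nonneg fun a _ => by positivity),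
      ← Finset.mul_sum]
    refine ENNReal.ofReal_le_ofReal ?_
    have hharm : ∑ a ∈ Finset.range ⌊y⌋₊, ((a : ℝ) + 1)⁻¹ ≤ L := by
      have := harmonic_floor_le_one_add_log y hy
      simpa [harmonic] using this
    have h3 : 1 ≤ L ^ (m + 1) := one_le_pow₀ hL
    calc 1 / y + C * L ^ m / y * ∑ a ∈ Finset.range ⌊y⌋₊, ((a : ℝ) + 1)⁻¹
        ≤ L ^ (m + 1) / y + C * L ^ m / y * L := by gcongr
      _ = _ := by ring

lemma le_unitVol_cfProd (m : ℕ) : ∃ c : ℝ, 0 < c ∧ ∀ y : ℝ, 1 ≤ y →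
    ENNReal.ofReal (c * (Real.log y ^ m / y)) ≤ unitVol {x | y ≤ cfProd (m + 1) x} := by
  induction m with
  | zero =>
    refine ⟨1 / 2, by norm_num, fun y hy => ?_⟩
    have hy0 : 0 < y := by linarith
    have hsub : Ioo 0 (1 / (y + 1)) ⊆ {x | y ≤ cfProd (0 + 1) x} ∩ Ioo 0 1 := fun x hx => by
      have h1 : y + 1 < x⁻¹ := by
        rw [lt_inv_comm₀ (by positivity) hx.1, ← one_div]; exact hx.2
      refine ⟨?_, hx.1, hx.2.trans ((div_lt_one (by positivity)).2 (by linarith))⟩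
      have := Nat.lt_floor_add_one x⁻¹
      simp only [cfProd, cfA, mem_ofPred_eq, zero_add, Finset.range_one, Finset.prod_singleton,
        Nat.sub_self, Function.iterate_zero, id]
      linarith
    rw [Measure.restrict_apply (measurableSet_le_cfProd _ y)]
    refine le_trans ?_ (measure_mono hsub)
    rw [Real.volume_Ioo, sub_zero]
    refine ENNReal.ofReal_le_ofReal ?_
    rw [pow_zero, one_div_mul_one_div, div_le_div_iff₀ (by positivity) (by positivity)]
    linarith
  | succ m ih =>
    obtain ⟨c, hc, h⟩ := ih
    refine ⟨c / (4 * 2 ^ (m + 1)), by positivity, fun y hy => ?_⟩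
    have hy0 : 0 < y := by linarith
    have hl : 0 ≤ Real.log y := Real.log_nonneg hy
    have hs0 : 0 < √y := Real.sqrt_pos.2 hy0
    have hs1 : 1 ≤ √y := Real.one_le_sqrt.2 hy
    have hlog : Real.log (√y) = Real.log y / 2 := Real.log_sqrt hy0.le
    set K := c * (Real.log y / 2) ^ m / (4 * y)
    have hterm : ∀ a ∈ Finset.range ⌊√y⌋₊, ENNReal.ofReal (K * ((a : ℝ) + 1)⁻¹) ≤
        ENNReal.ofReal (1 / ((a : ℝ) + 2) ^ 2) *
          unitVol {x | y / ((a : ℝ) + 1) ≤ cfProd (m + 1) x} := by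
      intro a ha
      rw [Finset.mem_range, ← Nat.add_one_le_iff, Nat.le_floor_iff hs0.le] at ha
      push_cast at ha
      have hsy : √y ≤ y / ((a : ℝ) + 1) := by
        rw [le_div_iff₀ (by positivity)]
        calc √y * ((a : ℝ) + 1) ≤ √y * √y := by gcongr
          _ = y := Real.mul_self_sqrt hy0.le
      refine le_trans ?_ (mul_le_mul' le_rfl (h _ (hs1.trans hsy)))
      rw [← ENNReal.ofReal_mul (by positivity)]
      refine ENNReal.ofReal_le_ofReal ?_
      have h2 : Real.log y / 2 ≤ Real.log (y / ((a : ℝ) + 1)) := by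
        rw [← hlog]; exact Real.log_le_log hs0 hsy
      have h3 : (a : ℝ) + 2 ≤ 2 * (a + 1) := by linarith [a.cast_nonneg (α := ℝ)]
      calc K * ((a : ℝ) + 1)⁻¹ =
          1 / (2 * ((a : ℝ) + 1)) ^ 2 * (c * ((Real.log y / 2) ^ m / (y / ((a : ℝ) + 1)))) := by
            simp only [K]; field_simp; ring
        _ ≤ _ := by gcongr
    refine le_trans ?_ (le_unitVol_cfProd_succ (m + 1) ⌊√y⌋₊ y)
    refine le_trans ?_ (Finset.sum_le_sum hterm)
    rw [← ENNReal.ofReal_sum_of_nonneg fun a _ => by positivity, ← Finset.mul_sum]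
    refine ENNReal.ofReal_le_ofReal ?_
    have hharm : Real.log y / 2 ≤ ∑ a ∈ Finset.range ⌊√y⌋₊, ((a : ℝ) + 1)⁻¹ := by
      have := log_le_harmonic_floor (√y) hs0.le
      rw [hlog] at this
      simpa [harmonic] using this
    calc c / (4 * 2 ^ (m + 1)) * (Real.log y ^ (m + 1) / y) = K * (Real.log y / 2) := by
          simp only [K, div_pow]; field_simp; ring
      _ ≤ _ := by gcongr

lemma exists_not_summable_residue {ℓ : ℕ} (hℓ : 1 ≤ ℓ) {s : ℕ → ℝ} (h0 : ∀ n, 0 ≤ s n)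
    (hs : ¬ Summable s) : ∃ r, ¬ Summable fun j => s (ℓ * j + r) := by
  by_contra! h
  have : NeZero ℓ := ⟨by omega⟩
  refine hs ?_
  rw [← ((Nat.divModEquiv ℓ).trans (Equiv.prodComm _ _)).symm.summable_iff]
  refine (summable_prod_of_nonneg fun _ => h0 _).2 ⟨fun r => ?_, Summable.of_finite⟩
  refine (h r).congr fun j => ?_
  simp [Nat.divModEquiv, mul_comm]

lemma infinite_cfA_iff (ℓ : ℕ) (φ : ℕ → ℝ) (x : ℝ) :
    {n : ℕ | 1 ≤ n ∧ φ n ≤ ∏ i ∈ Finset.range ℓ, (cfA x (n + i) : ℝ)}.Infinite ↔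
      ∃ᶠ n in atTop, φ (n + 1) ≤ cfProd ℓ (gaussMap^[n] x) := by
  simp_rw [← Nat.frequently_atTop_iff_infinite, cfProd_iterate]
  rw [frequently_atTop, frequently_atTop]
  constructor <;> intro h N
  · obtain ⟨n, hn, h1, h2⟩ := h (N + 1)
    refine ⟨n - 1, by omega, ?_⟩
    rwa [Nat.sub_add_cancel h1]
  · obtain ⟨n, hn, h2⟩ := h N
    exact ⟨n + 1, by omega, by omega, h2⟩

lemma volume_Eℓ_eq_zero (m : ℕ) {φ : ℕ → ℝ} (hφ : ∀ n, 2 ≤ φ n)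
    (hs : Summable fun n : ℕ => Real.log (φ n) ^ m / φ n) : volume (Eℓ (m + 1) φ) = 0 := by
  obtain ⟨C, hC, h⟩ := unitVol_cfProd_le m
  have hbound : ∀ n, unitVol (gaussMap^[n] ⁻¹' {x | φ (n + 1) ≤ cfProd (m + 1) x}) ≤
      ENNReal.ofReal (4 * C * 3 ^ m * (Real.log (φ (n + 1)) ^ m / φ (n + 1))) := by
    intro n
    have h2 := hφ (n + 1)
    have hlog : 1 / 2 ≤ Real.log (φ (n + 1)) :=
      le_trans (by linarith [Real.log_two_gt_d9]) (Real.log_le_log two_pos h2)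
    refine (unitVol_preimage_iterate_le n (measurableSet_le_cfProd _ _)).trans ?_
    refine (mul_le_mul' le_rfl (h _ (by linarith))).trans ?_
    rw [show (4 : ENNReal) = ENNReal.ofReal 4 by simp, ← ENNReal.ofReal_mul (by norm_num)]
    refine ENNReal.ofReal_le_ofReal ?_
    calc 4 * (C * ((1 + Real.log (φ (n + 1))) ^ m / φ (n + 1)))
        ≤ 4 * (C * ((3 * Real.log (φ (n + 1))) ^ m / φ (n + 1))) := by
          gcongr ?_ * (_ * (?_ ^ m / _))
          linarith
      _ = _ := by rw [mul_pow]; ring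
  have hzero : unitVol {x | ∃ᶠ n in atTop, φ (n + 1) ≤ cfProd (m + 1) (gaussMap^[n] x)} = 0 := by
    refine measure_setOfPred_frequently_eq_zero
      (ne_top_of_le_ne_top ?_ (ENNReal.tsum_le_tsum hbound))
    exact (((summable_nat_add_iff 1).2 hs).mul_left _).tsum_ofReal_ne_top
  refine measure_mono_null (t := _ ∩ Ioo 0 1) (fun x hx => ?_)
    (le_zero_iff.1 ((Measure.le_restrict_apply _ _).trans_eq hzero))
  exact ⟨(infinite_cfA_iff _ _ _).1 hx.2.2, lt_of_le_of_ne hx.1.1 hx.2.1.ne_zero.symm, hx.1.2⟩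

lemma volume_Eℓ_eq_one (m : ℕ) {φ : ℕ → ℝ} (hφ : ∀ n, 2 ≤ φ n)
    (hs : ¬ Summable fun n : ℕ => Real.log (φ n) ^ m / φ n) : volume (Eℓ (m + 1) φ) = 1 := by
  obtain ⟨c, hc, h⟩ := le_unitVol_cfProd m
  have h0 : ∀ n, 0 ≤ Real.log (φ n) ^ m / φ n := fun n => by
    have := hφ n
    have := Real.log_nonneg (show 1 ≤ φ n by linarith)
    positivity
  have hs' : ¬ Summable fun n : ℕ => Real.log (φ (n + 1)) ^ m / φ (n + 1) := fun h =>
    hs ((summable_nat_add_iff (f := fun n : ℕ => Real.log (φ n) ^ m / φ n) 1).1 h)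
  obtain ⟨r, hr⟩ := exists_not_summable_residue (le_add_self : 1 ≤ m + 1)
    (fun n => h0 (n + 1)) hs'
  obtain ⟨y, hy⟩ : ∃ y : ℕ → ℕ → ℝ, ∀ K j, y K j = φ ((m + 1) * (j + K) + r + 1) :=
    ⟨_, fun _ _ => rfl⟩
  have htop : ∀ K, ∑' j, unitVol {x | y K j ≤ cfProd (m + 1) x} = ⊤ := by
    intro K
    by_contra hne
    refine mt (summable_nat_add_iff K).1 hr ?_
    have h1 : ∑' j, ENNReal.ofReal (c * (Real.log (y K j) ^ m / y K j)) ≠ ⊤ := by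
      refine ne_top_of_le_ne_top hne (ENNReal.tsum_le_tsum fun j => h _ ?_)
      rw [hy]
      linarith [hφ ((m + 1) * (j + K) + r + 1)]
    have h2 := ENNReal.summable_toReal h1
    simp_rw [hy, ENNReal.toReal_ofReal (mul_nonneg hc.le (h0 _))] at h2
    exact (summable_mul_left_iff hc.ne').1 h2
  have hnull : ∀ K, unitVol (gaussMap^[(m + 1) * K + r] ⁻¹'
      {x | ∀ j, cfProd (m + 1) (gaussMap^[(m + 1) * j] x) < y K j}) = 0 := by
    intro K
    have hmeas : MeasurableSet {x | ∀ j, cfProd (m + 1) (gaussMap^[(m + 1) * j] x) < y K j} := by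
      rw [ofPred_forall]
      exact MeasurableSet.iInter fun j =>
        (measurable_gaussMap.iterate _) (measurableSet_cfProd_lt (m + 1) (y K j))
    refine le_zero_iff.1 ((unitVol_preimage_iterate_le _ hmeas).trans_eq ?_)
    rw [unitVol_forall_lt_eq_zero (htop K), mul_zero]
  have hae : ∀ᵐ x ∂unitVol, x ∈ Eℓ (m + 1) φ := by
    have h1 : ∀ᵐ x ∂unitVol, Irrational x := ae_restrict_of_ae ae_irrational
    have h2 : ∀ᵐ x ∂unitVol, x ∈ Ioo (0 : ℝ) 1 := ae_restrict_mem measurableSet_Ioo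
    have h3 : ∀ᵐ x ∂unitVol, ∀ K, x ∉ gaussMap^[(m + 1) * K + r] ⁻¹'
        {x | ∀ j, cfProd (m + 1) (gaussMap^[(m + 1) * j] x) < y K j} :=
      ae_all_iff.2 fun K => measure_eq_zero_iff_ae_notMem.1 (hnull K)
    filter_upwards [h1, h2, h3] with x hx1 hx2 hx3
    refine ⟨⟨hx2.1.le, hx2.2⟩, hx1, (infinite_cfA_iff _ _ _).2 (frequently_atTop.2 fun K => ?_)⟩
    have h4 := hx3 K
    simp only [mem_preimage, mem_ofPred_eq, not_forall, not_lt] at h4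
    obtain ⟨j, hj⟩ := h4
    rw [← Function.iterate_add_apply, ← add_assoc, ← mul_add, hy] at hj
    have hK : K ≤ (m + 1) * (j + K) := le_trans (by omega) (Nat.le_mul_of_pos_left _ m.succ_pos)
    exact ⟨(m + 1) * (j + K) + r, by omega, hj⟩
  refine le_antisymm ?_ ?_
  · calc volume (Eℓ (m + 1) φ) ≤ volume (Ico (0 : ℝ) 1) := measure_mono fun x hx => hx.1
      _ = 1 := by simp
  · calc 1 = unitVol univ := measure_univ.symm
      _ ≤ unitVol (Eℓ (m + 1) φ) := measure_mono_ae (hae.mono fun x hx _ => hx)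
      _ ≤ volume (Eℓ (m + 1) φ) := Measure.restrict_apply_le _ _

/-- **Theorem (Huang–Wu–Xu).** Let `ℓ ≥ 1` and `φ : ℕ → [2, ∞)`. If
`∑_n (log φ(n))^{ℓ-1} / φ(n)` converges then `leb(E_ℓ(φ)) = 0`, and if it diverges then
`leb(E_ℓ(φ)) = 1`. -/
theorem lebesgue_measure_Eℓ (ℓ : ℕ) (hℓ : 1 ≤ ℓ) (φ : ℕ → ℝ) (hφ : ∀ n, 2 ≤ φ n) :
    (Summable (fun n : ℕ => Real.log (φ n) ^ (ℓ - 1) / φ n) → volume (Eℓ ℓ φ) = 0) ∧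
    (¬ Summable (fun n : ℕ => Real.log (φ n) ^ (ℓ - 1) / φ n) → volume (Eℓ ℓ φ) = 1) := by
  obtain ⟨m, rfl⟩ : ∃ m, ℓ = m + 1 := ⟨ℓ - 1, by omega⟩
  exact ⟨volume_Eℓ_eq_zero m hφ, volume_Eℓ_eq_one m hφ⟩
end

section
/- For all reals b, c > 1, the Hausdorff dimension of the set { x ∈ [0,1] irrational : a_n(x) ≥ c^{b^{n}} for all n ∈ ℕ } and the Hausdorff dimension of E_1(φ_{b,c}) are both equal to 1/(b+1). -/
open MeasureTheory Filter Set

/-- `E₁ φ` is the set of irrational `x ∈ [0,1)` such that `a_n(x) ≥ φ(n)` for infinitely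
many `n ∈ ℕ`. -/
noncomputable def E₁ (φ : ℕ → ℝ) : Set ℝ :=
  {x | x ∈ Set.Ico (0 : ℝ) 1 ∧ Irrational x ∧
    {n : ℕ | 1 ≤ n ∧ φ n ≤ (cfA x n : ℝ)}.Infinite}

open scoped Topology ENNReal NNReal

theorem hausdorffMeasure_setOf_infinite_mem_eq_zero {X ι : Type*} [EMetricSpace X]
    [MeasurableSpace X] [BorelSpace X] [Countable ι] (t : ι → Set X) {d : ℝ} (hd : 0 < d)
    (h : ∑' i, Metric.ediam (t i) ^ d ≠ ∞) :
    μH[d] {x | {i | x ∈ t i}.Infinite} = 0 := by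
  have hlim := ENNReal.tendsto_tsum_compl_atTop_zero h
  have hr : Tendsto (fun s : Finset ι ↦ (∑' i : {i // i ∉ s}, Metric.ediam (t i) ^ d) ^ d⁻¹)
      atTop (𝓝 0) := by
    have := hlim.ennrpow_const d⁻¹
    rwa [ENNReal.zero_rpow_of_pos (inv_pos.2 hd)] at this
  have key := Measure.hausdorffMeasure_le_liminf_tsum (ι := fun s : Finset ι ↦ {i // i ∉ s}) d
    {x | {i | x ∈ t i}.Infinite} _ hr (fun s i ↦ t i)
    (Eventually.of_forall fun s i ↦ by
      rw [ENNReal.le_rpow_inv_iff hd]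
      exact ENNReal.le_tsum (f := fun i : {i // i ∉ s} ↦ Metric.ediam (t i) ^ d) i)
    (Eventually.of_forall fun s x hx ↦ by
      obtain ⟨i, hi, his⟩ := Set.Infinite.exists_notMem_finset hx s
      exact mem_iUnion.2 ⟨⟨i, his⟩, hi⟩)
  rw [hlim.liminf_eq] at key
  exact le_antisymm key bot_le

theorem ENNReal.tsum_prod_fin_eq_pow (f : ℕ → ℝ≥0∞) (n : ℕ) :
    ∑' v : Fin n → ℕ, ∏ i, f (v i) = (∑' k, f k) ^ n := by
  induction n with
  | zero => simp [tsum_fintype]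
  | succ n ih =>
    rw [← (Fin.consEquiv fun _ : Fin (n + 1) ↦ ℕ).tsum_eq, ENNReal.tsum_prod', pow_succ', ← ih,
      ← ENNReal.tsum_mul_right]
    refine tsum_congr fun k ↦ ?_
    rw [← ENNReal.tsum_mul_left]
    refine tsum_congr fun v ↦ ?_
    simp [Fin.consEquiv, Fin.prod_univ_succ]

theorem gaussMap_mem_Ioo_and_irrational {x : ℝ} (hx : Irrational x) :
    gaussMap x ∈ Ioo (0 : ℝ) 1 ∧ Irrational (gaussMap x) := by
  have h : Irrational (Int.fract x⁻¹) := by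
    rw [Int.fract]
    exact hx.inv.sub_intCast _
  rw [gaussMap, if_neg hx.ne_zero]
  exact ⟨⟨(Int.fract_nonneg _).lt_of_ne' h.ne_zero, Int.fract_lt_one _⟩, h⟩

theorem iterate_gaussMap_mem_Ioo_and_irrational {x : ℝ} (hx : x ∈ Ioo (0 : ℝ) 1)
    (hi : Irrational x) (n : ℕ) :
    gaussMap^[n] x ∈ Ioo (0 : ℝ) 1 ∧ Irrational (gaussMap^[n] x) := by
  induction n with
  | zero => exact ⟨hx, hi⟩
  | succ n ih =>
    rw [Function.iterate_succ_apply']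
    exact gaussMap_mem_Ioo_and_irrational ih.2

theorem one_le_cfA_succ {x : ℝ} (hx : x ∈ Ioo (0 : ℝ) 1) (hi : Irrational x) (n : ℕ) :
    1 ≤ cfA x (n + 1) := by
  obtain ⟨⟨h0, h1⟩, -⟩ := iterate_gaussMap_mem_Ioo_and_irrational hx hi n
  exact Nat.le_floor (by simpa using (one_le_inv₀ h0).2 h1.le)

theorem iterate_gaussMap_eq_inv {x : ℝ} (hx : x ∈ Ioo (0 : ℝ) 1) (hi : Irrational x) (n : ℕ) :
    gaussMap^[n] x = (cfA x (n + 1) + gaussMap^[n + 1] x)⁻¹ := by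
  obtain ⟨⟨h0, h1⟩, -⟩ := iterate_gaussMap_mem_Ioo_and_irrational hx hi n
  rw [Function.iterate_succ_apply', gaussMap, if_neg h0.ne', cfA, Nat.add_sub_cancel,
    natCast_floor_eq_intCast_floor (inv_nonneg.2 h0.le), Int.floor_add_fract, inv_inv]

/-- The inverse branches of the Gauss map contract by a factor at least the product of the
squared partial quotients. -/
theorem abs_sub_le_div_prod_sq {t t' : ℕ → ℝ} {a : ℕ → ℕ} {n : ℕ}
    (ha : ∀ i < n, 1 ≤ a i) (h0 : ∀ i, 0 ≤ t i) (h0' : ∀ i, 0 ≤ t' i)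
    (ht : ∀ i < n, t i = (a i + t (i + 1))⁻¹) (ht' : ∀ i < n, t' i = (a i + t' (i + 1))⁻¹) :
    |t 0 - t' 0| ≤ |t n - t' n| / ∏ i ∈ Finset.range n, (a i : ℝ) ^ 2 := by
  induction n with
  | zero => simp
  | succ n ih =>
    refine (ih (fun i hi ↦ ha i (by omega)) (fun i hi ↦ ht i (by omega))
      (fun i hi ↦ ht' i (by omega))).trans ?_
    rw [Finset.prod_range_succ, mul_comm, ← div_div]
    have hpos : (1 : ℝ) ≤ a n := by exact_mod_cast ha n (by omega)
    have h1 := h0 (n + 1)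
    have h1' := h0' (n + 1)
    refine div_le_div_of_nonneg_right ?_ (by positivity)
    rw [ht n (by omega), ht' n (by omega), inv_sub_inv (by positivity) (by positivity), abs_div,
      abs_of_pos (a := _ * _) (by positivity), add_sub_add_left_eq_sub, abs_sub_comm]
    gcongr
    nlinarith

/-- The inverse branches of the Gauss map contract by a factor at most the product of the
squares of the partial quotients plus one. -/
theorem div_prod_sq_le_abs_sub {t t' : ℕ → ℝ} {a : ℕ → ℕ} {n : ℕ}
    (ha : ∀ i < n, 1 ≤ a i) (h0 : ∀ i, t i ∈ Icc (0 : ℝ) 1) (h0' : ∀ i, t' i ∈ Icc (0 : ℝ) 1)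
    (ht : ∀ i < n, t i = (a i + t (i + 1))⁻¹) (ht' : ∀ i < n, t' i = (a i + t' (i + 1))⁻¹) :
    |t n - t' n| / ∏ i ∈ Finset.range n, ((a i : ℝ) + 1) ^ 2 ≤ |t 0 - t' 0| := by
  induction n with
  | zero => simp
  | succ n ih =>
    refine le_trans ?_ (ih (fun i hi ↦ ha i (by omega)) (fun i hi ↦ ht i (by omega))
      (fun i hi ↦ ht' i (by omega)))
    rw [Finset.prod_range_succ, mul_comm, ← div_div]
    have hpos : (1 : ℝ) ≤ a n := by exact_mod_cast ha n (by omega)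
    obtain ⟨h1, h2⟩ := h0 (n + 1)
    obtain ⟨h1', h2'⟩ := h0' (n + 1)
    refine div_le_div_of_nonneg_right ?_ (by positivity)
    rw [ht n (by omega), ht' n (by omega), inv_sub_inv (by positivity) (by positivity), abs_div,
      abs_of_pos (a := _ * _) (by positivity), add_sub_add_left_eq_sub, abs_sub_comm]
    gcongr
    nlinarith

theorem tendsto_const_mul_pow_sub_mul_atTop {β ε : ℝ} (hβ : 1 < β) (hε : 0 < ε) (A : ℝ) :
    Tendsto (fun n : ℕ ↦ ε * β ^ n - A * n) atTop atTop := by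
  have h1 : Tendsto (fun n : ℕ ↦ ε - A * ((n : ℝ) ^ 1 / β ^ n)) atTop (𝓝 ε) := by
    simpa using ((tendsto_pow_const_div_const_pow_of_one_lt 1 hβ).const_mul A).const_sub ε
  refine ((tendsto_pow_atTop_atTop_of_one_lt hβ).atTop_mul_pos hε h1).congr fun n ↦ ?_
  have : β ^ n ≠ 0 := by positivity
  field_simp

theorem summable_exp_neg_mul_pow_mul_pow {β s ζ : ℝ} (hβ : 1 < β) (hs : 0 < s) (hζ : 0 < ζ) :
    Summable fun n : ℕ ↦ Real.exp (-(s * β ^ n)) * ζ ^ n := by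
  refine summable_of_isBigO_nat (Real.summable_exp_neg_nat) (Asymptotics.IsBigO.of_bound 1 ?_)
  have hlim := tendsto_const_mul_pow_sub_mul_atTop hβ hs (Real.log ζ + 1)
  filter_upwards [hlim.eventually_ge_atTop 0] with n hn
  rw [← Real.exp_log hζ, ← Real.exp_nat_mul, ← Real.exp_add, one_mul,
    Real.norm_of_nonneg (Real.exp_pos _).le, Real.norm_of_nonneg (Real.exp_pos _).le,
    Real.exp_le_exp]
  linarith

/-- If `a n` is infinitely often at least `c ^ b ^ (n + 1)`, then infinitely often it is also large
compared to the product of the preceding terms. -/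
theorem infinite_setOf_mul_sum_log_add_pow_le {b c κ β : ℝ} (hc : 1 < c) (hκ : 0 < κ)
    (hβ : κ + 1 < β) (hb : β < b) {a : ℕ → ℕ}
    (h : {n : ℕ | c ^ b ^ (n + 1) ≤ (a n : ℝ)}.Infinite) :
    {n : ℕ | κ * ∑ i ∈ Finset.range n, Real.log (a i) + β ^ n ≤ Real.log (a n)}.Infinite := by
  by_contra hfin
  rw [← Nat.frequently_atTop_iff_infinite, not_frequently] at hfin
  obtain ⟨N, hN⟩ := eventually_atTop.1 hfin
  set L : ℕ → ℝ := fun n ↦ ∑ i ∈ Finset.range n, Real.log (a i) with hL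
  have hlog : ∀ i, 0 ≤ Real.log (a i) := fun i ↦ Real.log_natCast_nonneg _
  have hL0 : ∀ n, 0 ≤ L n := fun n ↦ Finset.sum_nonneg fun i _ ↦ hlog i
  have hβ0 : 0 < β := by linarith
  set K : ℝ := max (L N / β ^ N) (1 / (β - κ - 1)) with hK
  have hK1 : 1 ≤ K * (β - κ - 1) := (div_le_iff₀ (by linarith)).1 (le_max_right _ _)
  have hbound : ∀ n, N ≤ n → L n ≤ K * β ^ n := by
    intro n hn
    induction n, hn using Nat.le_induction with
    | base => exact (div_le_iff₀ (by positivity)).1 (le_max_left _ _)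
    | succ n hn ih =>
      have h1 : Real.log (a n) < κ * L n + β ^ n := not_le.1 (hN n hn)
      have h2 : L (n + 1) = L n + Real.log (a n) := Finset.sum_range_succ _ _
      rw [h2, pow_succ]
      have : 0 < β ^ n := by positivity
      nlinarith
  have hlogc : 0 < Real.log c := Real.log_pos hc
  have hratio : ∀ᶠ n : ℕ in atTop, K * β ^ (n + 1) < b ^ (n + 1) * Real.log c := by
    have ht := (tendsto_pow_atTop_atTop_of_one_lt ((one_lt_div hβ0).2 hb)).comp
      (tendsto_add_atTop_nat 1)
    filter_upwards [ht.eventually_gt_atTop (K / Real.log c)] with n hn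
    rw [Function.comp_apply, div_pow, div_lt_div_iff₀ hlogc (by positivity)] at hn
    exact hn
  obtain ⟨n, hn, hn1, hn2⟩ := ((Nat.frequently_atTop_iff_infinite.2 h).and_eventually
    (hratio.and (eventually_ge_atTop N))).exists
  have h3 := Real.log_le_log (by positivity) (show c ^ b ^ (n + 1) ≤ (a n : ℝ) from hn)
  rw [Real.log_rpow (by linarith)] at h3
  have h4 : L (n + 1) = L n + Real.log (a n) := Finset.sum_range_succ _ _
  have := hbound (n + 1) (by omega)
  linarith [hL0 n]

/-- The points of `(0, 1)` whose expansion starts with `v 0 + 1, …, v (n - 1) + 1` and whose next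
partial quotient is large in terms of these. -/
def largeNextCylinder (κ β : ℝ) (p : Σ n : ℕ, Fin n → ℕ) : Set ℝ :=
  {x | x ∈ Ioo (0 : ℝ) 1 ∧ Irrational x ∧ (∀ i : Fin p.1, cfA x (i + 1) = p.2 i + 1) ∧
    κ * ∑ i, Real.log ((p.2 i : ℝ) + 1) + β ^ p.1 ≤ Real.log (cfA x (p.1 + 1))}

theorem iterate_gaussMap_le_of_mem_largeNextCylinder {κ β x : ℝ} {p : Σ n : ℕ, Fin n → ℕ}
    (hx : x ∈ largeNextCylinder κ β p) :
    gaussMap^[p.1] x ≤ Real.exp (-β ^ p.1) * ∏ i, ((p.2 i : ℝ) + 1) ^ (-κ) := by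
  obtain ⟨hx1, hi, -, hx2⟩ := hx
  have hpos : (0 : ℝ) < cfA x (p.1 + 1) := by exact_mod_cast one_le_cfA_succ hx1 hi p.1
  have h0 := (iterate_gaussMap_mem_Ioo_and_irrational hx1 hi (p.1 + 1)).1.1
  rw [iterate_gaussMap_eq_inv hx1 hi]
  calc _ ≤ ((cfA x (p.1 + 1) : ℝ))⁻¹ := by gcongr; linarith
    _ = Real.exp (-Real.log (cfA x (p.1 + 1))) := by rw [Real.exp_neg, Real.exp_log hpos]
    _ ≤ Real.exp (-β ^ p.1 + ∑ i, Real.log ((p.2 i : ℝ) + 1) * (-κ)) := by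
      rw [← Finset.sum_mul]
      gcongr
      linarith
    _ = _ := by
      rw [Real.exp_add, Real.exp_sum]
      congr 1
      refine Finset.prod_congr rfl fun i _ ↦ ?_
      rw [Real.rpow_def_of_pos (by positivity)]

theorem ediam_largeNextCylinder_le (κ β : ℝ) (p : Σ n : ℕ, Fin n → ℕ) :
    Metric.ediam (largeNextCylinder κ β p) ≤
      ENNReal.ofReal (Real.exp (-β ^ p.1) * ∏ i, ((p.2 i : ℝ) + 1) ^ (-(2 + κ))) := by
  refine Metric.ediam_le fun x hx y hy ↦ ?_
  rw [edist_dist, Real.dist_eq]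
  refine ENNReal.ofReal_le_ofReal ?_
  have hx' := iterate_gaussMap_le_of_mem_largeNextCylinder hx
  have hy' := iterate_gaussMap_le_of_mem_largeNextCylinder hy
  obtain ⟨hx1, hxi, hxv, -⟩ := hx
  obtain ⟨hy1, hyi, hyv, -⟩ := hy
  have hx0 := fun n ↦ (iterate_gaussMap_mem_Ioo_and_irrational hx1 hxi n).1
  have hy0 := fun n ↦ (iterate_gaussMap_mem_Ioo_and_irrational hy1 hyi n).1
  have key := abs_sub_le_div_prod_sq (t := fun n ↦ gaussMap^[n] x) (t' := fun n ↦ gaussMap^[n] y)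
    (a := fun n ↦ cfA x (n + 1)) (n := p.1)
    (fun i _ ↦ one_le_cfA_succ hx1 hxi i) (fun i ↦ (hx0 i).1.le) (fun i ↦ (hy0 i).1.le)
    (fun i _ ↦ iterate_gaussMap_eq_inv hx1 hxi i)
    (fun i hi ↦ by
      have : cfA x (i + 1) = cfA y (i + 1) := (hxv ⟨i, hi⟩).trans (hyv ⟨i, hi⟩).symm
      simp only [this]
      exact iterate_gaussMap_eq_inv hy1 hyi i)
  refine key.trans ?_
  have hprod : ∏ i ∈ Finset.range p.1, (cfA x (i + 1) : ℝ) ^ 2 = ∏ i, ((p.2 i : ℝ) + 1) ^ 2 := by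
    rw [← Fin.prod_univ_eq_prod_range fun i ↦ (cfA x (i + 1) : ℝ) ^ 2]
    refine Finset.prod_congr rfl fun i _ ↦ ?_
    rw [hxv i]
    push_cast
    rfl
  rw [hprod, div_le_iff₀ (by positivity), mul_assoc, ← Finset.prod_mul_distrib]
  have : ∀ i, ((p.2 i : ℝ) + 1) ^ (-(2 + κ)) * ((p.2 i : ℝ) + 1) ^ 2 =
      ((p.2 i : ℝ) + 1) ^ (-κ) := by
    intro i
    rw [← Real.rpow_natCast, ← Real.rpow_add (by positivity)]
    congr 1
    push_cast
    ring
  simp only [this]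
  have h1 := hx0 p.1
  have h2 := hy0 p.1
  exact abs_le.2 ⟨by linarith [h1.1], by linarith [h2.1]⟩

theorem tsum_ediam_largeNextCylinder_ne_top {κ β s : ℝ} (hβ : 1 < β) (hs : 0 < s)
    (hsκ : 1 < s * (2 + κ)) :
    ∑' p, Metric.ediam (largeNextCylinder κ β p) ^ s ≠ ∞ := by
  have hsum : Summable fun k : ℕ ↦ ((k : ℝ) + 1) ^ (-(s * (2 + κ))) := by
    have := (summable_nat_add_iff 1).2 (Real.summable_nat_rpow.2 (neg_lt_neg hsκ))
    simpa using this
  set ζ : ℝ := ∑' k : ℕ, ((k : ℝ) + 1) ^ (-(s * (2 + κ)))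
  have hζ : 0 < ζ := hsum.tsum_pos (fun k ↦ by positivity) 0 (by simp)
  have hle : ∀ p : Σ n : ℕ, Fin n → ℕ, Metric.ediam (largeNextCylinder κ β p) ^ s ≤
      ENNReal.ofReal (Real.exp (-(s * β ^ p.1))) *
        ∏ i, ENNReal.ofReal (((p.2 i : ℝ) + 1) ^ (-(s * (2 + κ)))) := by
    intro p
    refine (ENNReal.rpow_le_rpow (ediam_largeNextCylinder_le κ β p) hs.le).trans_eq ?_
    rw [ENNReal.ofReal_rpow_of_nonneg (by positivity) hs.le,
      Real.mul_rpow (by positivity) (by positivity),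
      ENNReal.ofReal_mul (by positivity), ← Real.exp_mul,
      ← Real.finsetProd_rpow _ _ (fun i _ ↦ by positivity),
      ENNReal.ofReal_prod_of_nonneg (fun i _ ↦ by positivity)]
    congr 2
    · ring_nf
    · funext i
      rw [← Real.rpow_mul (by positivity)]
      ring_nf
  refine ne_top_of_le_ne_top ?_ (ENNReal.tsum_le_tsum hle)
  rw [ENNReal.tsum_sigma']
  have : ∀ n : ℕ, ∑' v : Fin n → ℕ, ENNReal.ofReal (Real.exp (-(s * β ^ n))) *
        ∏ i, ENNReal.ofReal (((v i : ℝ) + 1) ^ (-(s * (2 + κ)))) =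
      ENNReal.ofReal (Real.exp (-(s * β ^ n)) * ζ ^ n) := by
    intro n
    rw [ENNReal.tsum_mul_left, ENNReal.tsum_prod_fin_eq_pow
      (fun k ↦ ENNReal.ofReal (((k : ℝ) + 1) ^ (-(s * (2 + κ))))),
      ← ENNReal.ofReal_tsum_of_nonneg (fun k ↦ by positivity) hsum,
      ENNReal.ofReal_mul (by positivity), ENNReal.ofReal_pow hζ.le]
  simp only [this]
  exact (summable_exp_neg_mul_pow_mul_pow hβ hs hζ).tsum_ofReal_ne_top

theorem dimH_E₁_le {b c : ℝ} (hb : 1 < b) (hc : 1 < c) :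
    dimH (E₁ fun n ↦ c ^ (b ^ n)) ≤ ENNReal.ofReal (1 / (b + 1)) := by
  refine dimH_le fun s hs ↦ ?_
  by_contra! hlt
  rw [ENNReal.ofReal_lt_coe_iff (by positivity), div_lt_iff₀ (by positivity)] at hlt
  have hs0 : (0 : ℝ) < s := by nlinarith [s.coe_nonneg]
  obtain ⟨κ, hκ1, hκ2⟩ : ∃ κ, max 0 (1 / s - 2 : ℝ) < κ ∧ κ < b - 1 := by
    refine exists_between (max_lt (by linarith) ?_)
    rw [sub_lt_iff_lt_add, div_lt_iff₀ hs0]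
    linarith
  obtain ⟨hκ0, hκs⟩ := max_lt_iff.1 hκ1
  rw [sub_lt_iff_lt_add, div_lt_iff₀ hs0] at hκs
  obtain ⟨β, hβ1, hβ2⟩ : ∃ β, κ + 1 < β ∧ β < b := exists_between (by linarith)
  have hnull := hausdorffMeasure_setOf_infinite_mem_eq_zero (largeNextCylinder κ β) hs0
    (tsum_ediam_largeNextCylinder_ne_top (by linarith) hs0 (by linarith))
  refine ENNReal.zero_ne_top ((measure_mono_null ?_ hnull).symm.trans hs)
  rintro x ⟨hx, hi, hinf⟩
  have hx1 : x ∈ Ioo (0 : ℝ) 1 := ⟨hx.1.lt_of_ne' hi.ne_zero, hx.2⟩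
  have h1 : {n : ℕ | c ^ b ^ (n + 1) ≤ (cfA x (n + 1) : ℝ)}.Infinite := by
    refine Infinite.of_image (· + 1) (hinf.mono ?_)
    rintro n ⟨hn1, hn2⟩
    refine ⟨n - 1, ?_, by simp; omega⟩
    simpa [Nat.sub_add_cancel hn1] using hn2
  have h2 := infinite_setOf_mul_sum_log_add_pow_le hc hκ0 hβ1 hβ2 h1
  have hinj : Function.Injective
      fun n : ℕ ↦ (⟨n, fun i ↦ cfA x (i + 1) - 1⟩ : Σ n : ℕ, Fin n → ℕ) :=
    fun m n h ↦ congrArg Sigma.fst h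
  refine (h2.image hinj.injOn).mono ?_
  rintro _ ⟨n, hn, rfl⟩
  have hsub : ∀ i, cfA x (i + 1) - 1 + 1 = cfA x (i + 1) := fun i ↦
    Nat.sub_add_cancel (one_le_cfA_succ hx1 hi i)
  refine ⟨hx1, hi, fun i ↦ (hsub i).symm, ?_⟩
  have hsub' : ∀ i, (((cfA x (i + 1) - 1 : ℕ) : ℝ) + 1) = cfA x (i + 1) := fun i ↦ by
    exact_mod_cast hsub i
  simp only [hsub']
  rw [Fin.sum_univ_eq_sum_range fun i ↦ Real.log (cfA x (i + 1))]
  exact hn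

/-- Every sequence of positive integers is the sequence of partial quotients of a continued
fraction; `t n` is its `n`-th tail. -/
theorem exists_forall_mem_Icc_and_eq_inv {a : ℕ → ℕ} (ha : ∀ n, 1 ≤ a n) :
    ∃ t : ℕ → ℝ, (∀ n, t n ∈ Icc (0 : ℝ) 1) ∧ ∀ n, t n = (a n + t (n + 1))⁻¹ := by
  set K : ℕ → Set (ℕ → ℝ) := fun N ↦
    (Set.univ.pi fun _ ↦ Icc (0 : ℝ) 1) ∩ {t | ∀ n < N, t n * (a n + t (n + 1)) = 1} with hK
  have hne : ∀ N, ∀ a : ℕ → ℕ, (∀ n, 1 ≤ a n) → ∃ t : ℕ → ℝ, (∀ n, t n ∈ Icc (0 : ℝ) 1) ∧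
      ∀ n < N, t n * (a n + t (n + 1)) = 1 := by
    intro N
    induction N with
    | zero => exact fun a _ ↦ ⟨fun _ ↦ 0, by simp, by simp⟩
    | succ N ih =>
      intro a ha
      obtain ⟨t, ht, ht'⟩ := ih (fun n ↦ a (n + 1)) fun n ↦ ha _
      have h1 : (1 : ℝ) ≤ a 0 := by exact_mod_cast ha 0
      have h2 : (1 : ℝ) ≤ a 0 + t 0 := by linarith [(ht 0).1]
      refine ⟨fun n ↦ n.casesOn (a 0 + t 0)⁻¹ t, ?_, ?_⟩
      · rintro (_ | n)
        · exact ⟨inv_nonneg.2 (by linarith), inv_le_one_of_one_le₀ h2⟩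
        · exact ht n
      · rintro (_ | n) hn
        · exact inv_mul_cancel₀ (by linarith)
        · exact ht' n (by omega)
  have hcl : ∀ N, IsClosed {t : ℕ → ℝ | ∀ n < N, t n * (a n + t (n + 1)) = 1} := by
    intro N
    simp only [ofPred_forall]
    exact isClosed_iInter fun n ↦ isClosed_iInter fun _ ↦ isClosed_eq (by fun_prop) (by fun_prop)
  have hcpt : IsCompact (Set.univ.pi fun _ : ℕ ↦ Icc (0 : ℝ) 1) :=
    isCompact_univ_pi fun _ ↦ isCompact_Icc
  obtain ⟨t, ht⟩ := IsCompact.nonempty_iInter_of_sequence_nonempty_isCompact_isClosed K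
    (fun N t ht ↦ ⟨ht.1, fun n hn ↦ ht.2 n (by omega)⟩)
    (fun N ↦ by
      obtain ⟨t, h1, h2⟩ := hne N a ha
      exact ⟨t, fun n _ ↦ h1 n, h2⟩)
    (hcpt.inter_right (hcl 0)) (fun N ↦ hcpt.isClosed.inter (hcl N))
  rw [mem_iInter] at ht
  exact ⟨t, fun n ↦ (ht 0).1 n trivial,
    fun n ↦ eq_inv_of_mul_eq_one_left ((ht (n + 1)).2 n n.lt_succ_self)⟩

section Tails

variable {t : ℕ → ℝ} {a : ℕ → ℕ}

theorem mem_Ioc_of_eq_inv (ha : ∀ n, 2 ≤ a n) (h0 : ∀ n, t n ∈ Icc (0 : ℝ) 1)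
    (ht : ∀ n, t n = (a n + t (n + 1))⁻¹) (n : ℕ) : t n ∈ Ioc (0 : ℝ) 2⁻¹ := by
  have h1 : (2 : ℝ) ≤ a n := by exact_mod_cast ha n
  have h2 := (h0 (n + 1)).1
  rw [ht n]
  exact ⟨by positivity, by gcongr; linarith⟩

theorem iterate_gaussMap_eq_of_eq_inv (ha : ∀ n, 2 ≤ a n) (h0 : ∀ n, t n ∈ Icc (0 : ℝ) 1)
    (ht : ∀ n, t n = (a n + t (n + 1))⁻¹) (n : ℕ) : gaussMap^[n] (t 0) = t n := by
  induction n with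
  | zero => rfl
  | succ n ih =>
    have h1 := mem_Ioc_of_eq_inv ha h0 ht (n + 1)
    rw [Function.iterate_succ_apply', ih, gaussMap, if_neg (mem_Ioc_of_eq_inv ha h0 ht n).1.ne',
      ht n, inv_inv, Int.fract_natCast_add]
    exact Int.fract_eq_self.2 ⟨h1.1.le, h1.2.trans_lt (by norm_num)⟩

theorem cfA_succ_eq_of_eq_inv (ha : ∀ n, 2 ≤ a n) (h0 : ∀ n, t n ∈ Icc (0 : ℝ) 1)
    (ht : ∀ n, t n = (a n + t (n + 1))⁻¹) (n : ℕ) : cfA (t 0) (n + 1) = a n := by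
  have h1 := mem_Ioc_of_eq_inv ha h0 ht (n + 1)
  rw [cfA, Nat.add_sub_cancel, iterate_gaussMap_eq_of_eq_inv ha h0 ht, ht n, inv_inv,
    Nat.floor_eq_iff (by linarith [h1.1, (a n).cast_nonneg (α := ℝ)])]
  exact ⟨by linarith [h1.1], by linarith [h1.2]⟩

end Tails

/-- The `n`-th remainder of `y` in its expansion with respect to the mixed radix `M`. -/
noncomputable def radixRem (M : ℕ → ℕ) (y : ℝ) : ℕ → ℝ
  | 0 => y
  | n + 1 => Int.fract (M n * radixRem M y n)

/-- The `n`-th digit of `y` in its expansion with respect to the mixed radix `M`. -/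
noncomputable def radixDigit (M : ℕ → ℕ) (y : ℝ) (n : ℕ) : ℕ := ⌊M n * radixRem M y n⌋₊

section Radix

variable {M : ℕ → ℕ} {y y' : ℝ}

theorem radixRem_mem_Ico (hy : y ∈ Ico (0 : ℝ) 1) : ∀ n, radixRem M y n ∈ Ico (0 : ℝ) 1
  | 0 => hy
  | _ + 1 => ⟨Int.fract_nonneg _, Int.fract_lt_one _⟩

theorem mul_radixRem (hy : y ∈ Ico (0 : ℝ) 1) (n : ℕ) :
    M n * radixRem M y n = radixDigit M y n + radixRem M y (n + 1) := by
  have := (radixRem_mem_Ico (M := M) hy n).1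
  rw [radixDigit, natCast_floor_eq_intCast_floor (by positivity), radixRem, Int.floor_add_fract]

theorem radixDigit_lt (hM : ∀ n, 2 ≤ M n) (hy : y ∈ Ico (0 : ℝ) 1) (n : ℕ) :
    radixDigit M y n < M n := by
  obtain ⟨h0, h1⟩ := radixRem_mem_Ico (M := M) hy n
  have h2 : (2 : ℝ) ≤ M n := by exact_mod_cast hM n
  rw [radixDigit, Nat.floor_lt (by positivity)]
  nlinarith

theorem abs_sub_eq_abs_radixRem_sub_div (hM : ∀ n, 2 ≤ M n) (hy : y ∈ Ico (0 : ℝ) 1)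
    (hy' : y' ∈ Ico (0 : ℝ) 1) {n : ℕ} (h : ∀ i < n, radixDigit M y i = radixDigit M y' i) :
    |y - y'| = |radixRem M y n - radixRem M y' n| / ∏ i ∈ Finset.range n, (M i : ℝ) := by
  induction n with
  | zero => simp [radixRem]
  | succ n ih =>
    have h2 : (2 : ℝ) ≤ M n := by exact_mod_cast hM n
    rw [ih fun i hi ↦ h i (by omega), Finset.prod_range_succ, mul_comm, ← div_div]
    congr 1
    rw [eq_div_iff (by positivity), ← abs_of_pos (a := (M n : ℝ)) (by positivity), ← abs_mul,
      sub_mul, mul_comm, mul_radixRem hy, mul_comm,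
      mul_radixRem hy', h n n.lt_succ_self, add_sub_add_left_eq_sub]

theorem exists_radixDigit_ne (hM : ∀ n, 2 ≤ M n) (hy : y ∈ Ico (0 : ℝ) 1)
    (hy' : y' ∈ Ico (0 : ℝ) 1) (hne : y ≠ y') : ∃ n, radixDigit M y n ≠ radixDigit M y' n := by
  by_contra! h
  have hle : ∀ n : ℕ, |y - y'| ≤ (1 / 2) ^ n := by
    intro n
    obtain ⟨h0, h1⟩ := radixRem_mem_Ico (M := M) hy n
    obtain ⟨h0', h1'⟩ := radixRem_mem_Ico (M := M) hy' n
    rw [abs_sub_eq_abs_radixRem_sub_div hM hy hy' fun i (_ : i < n) ↦ h i, one_div_pow]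
    have hprod : (2 : ℝ) ^ n ≤ ∏ i ∈ Finset.range n, (M i : ℝ) := by
      rw [← Finset.card_range n, ← Finset.prod_const, Finset.card_range]
      exact Finset.prod_le_prod (by simp) fun i _ ↦ by exact_mod_cast hM i
    gcongr
    exact abs_le.2 ⟨by linarith, by linarith⟩
  have := ge_of_tendsto' (tendsto_pow_atTop_nhds_zero_of_lt_one (by norm_num)
    (by norm_num : (1 / 2 : ℝ) < 1)) hle
  exact hne (sub_eq_zero.1 (abs_nonpos_iff.1 this))

end Radix

/-- The map sending the continued fraction with partial quotients `M n + d n` to the number with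
mixed radix digits `d n` is Hölder continuous. -/
theorem abs_sub_le_mul_abs_sub_rpow {M : ℕ → ℕ} (hM : ∀ n, 2 ≤ M n) {s C : ℝ}
    (hs0 : 0 ≤ s) (hs1 : s ≤ 1)
    (hC : ∀ n, 2 * (8 * 4 ^ n * M n * (∏ i ∈ Finset.range n, (M i : ℝ)) ^ 2) ^ s ≤
      C * ∏ i ∈ Finset.range n, (M i : ℝ))
    {y y' : ℝ} (hy : y ∈ Ico (0 : ℝ) 1) (hy' : y' ∈ Ico (0 : ℝ) 1) (hne : y ≠ y') {t t' : ℕ → ℝ}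
    (h0 : ∀ n, t n ∈ Icc (0 : ℝ) 1) (h0' : ∀ n, t' n ∈ Icc (0 : ℝ) 1)
    (ht : ∀ n, t n = ((M n + radixDigit M y n : ℕ) + t (n + 1))⁻¹)
    (ht' : ∀ n, t' n = ((M n + radixDigit M y' n : ℕ) + t' (n + 1))⁻¹) :
    |y - y'| ≤ C * |t 0 - t' 0| ^ s := by
  classical
  have hex := exists_radixDigit_ne hM hy hy' hne
  obtain ⟨n, hn, hlt⟩ : ∃ n, radixDigit M y n ≠ radixDigit M y' n ∧
      ∀ i < n, radixDigit M y i = radixDigit M y' i :=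
    ⟨Nat.find hex, Nat.find_spec hex, fun i hi ↦ not_not.1 (Nat.find_min hex hi)⟩
  set P := ∏ i ∈ Finset.range n, (M i : ℝ) with hP
  have hM0 : ∀ i, (0 : ℝ) < M i := fun i ↦ by exact_mod_cast (by linarith [hM i] : 0 < M i)
  have hP0 : 0 < P := Finset.prod_pos fun i _ ↦ hM0 i
  have hm := hM0 n
  have hdm : (radixDigit M y n : ℝ) + 1 ≤ M n := by exact_mod_cast radixDigit_lt hM hy n
  have hdm' : (radixDigit M y' n : ℝ) + 1 ≤ M n := by exact_mod_cast radixDigit_lt hM hy' n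
  set m : ℝ := (M n : ℝ)
  set d : ℝ := (radixDigit M y n : ℝ) with hd
  set d' : ℝ := (radixDigit M y' n : ℝ) with hd'
  have hΔ1 : 1 ≤ |d - d'| := by
    have : (1 : ℤ) ≤ |(radixDigit M y n : ℤ) - radixDigit M y' n| :=
      Int.one_le_abs (sub_ne_zero.2 (by exact_mod_cast hn))
    have h : (1 : ℝ) ≤ |((radixDigit M y n : ℤ) : ℝ) - ((radixDigit M y' n : ℤ) : ℝ)| := by
      exact_mod_cast this
    simpa using h
  have hd0 : 0 ≤ d := Nat.cast_nonneg _
  have hd0' : 0 ≤ d' := Nat.cast_nonneg _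
  have hΔm : |d - d'| ≤ m := abs_le.2 ⟨by linarith, by linarith⟩
  set Δ := |d - d'|
  have hupper : |y - y'| ≤ 2 * (Δ / m) / P := by
    rw [abs_sub_eq_abs_radixRem_sub_div hM hy hy' hlt]
    gcongr
    rw [← mul_div_assoc, le_div_iff₀ hm, ← abs_of_pos hm, ← abs_mul, sub_mul,
      mul_comm, mul_radixRem hy, mul_comm, mul_radixRem hy', add_sub_add_comm]
    obtain ⟨h1, h2⟩ := radixRem_mem_Ico (M := M) hy (n + 1)
    obtain ⟨h1', h2'⟩ := radixRem_mem_Ico (M := M) hy' (n + 1)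
    have : |radixRem M y (n + 1) - radixRem M y' (n + 1)| ≤ 1 :=
      abs_le.2 ⟨by linarith, by linarith⟩
    linarith [abs_add_le (d - d') (radixRem M y (n + 1) - radixRem M y' (n + 1))]
  have hlower : Δ / m / (8 * 4 ^ n * m * P ^ 2) ≤ |t 0 - t' 0| := by
    have ha : ∀ i, 2 ≤ M i + radixDigit M y i := fun i ↦ (hM i).trans (Nat.le_add_right _ _)
    have ha' : ∀ i, 2 ≤ M i + radixDigit M y' i := fun i ↦ (hM i).trans (Nat.le_add_right _ _)
    have key := div_prod_sq_le_abs_sub (a := fun i ↦ M i + radixDigit M y i) (n := n)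
      (fun i _ ↦ one_le_two.trans (ha i)) h0 h0' (fun i _ ↦ ht i)
      (fun i hi ↦ by
        rw [hlt i hi]
        exact ht' i)
    refine le_trans ?_ key
    have hprod : ∏ i ∈ Finset.range n, (((M i + radixDigit M y i : ℕ) : ℝ) + 1) ^ 2 ≤
        4 ^ n * P ^ 2 := by
      rw [hP, ← Finset.prod_pow, ← Finset.card_range n, ← Finset.prod_const, Finset.card_range,
        ← Finset.prod_mul_distrib]
      refine Finset.prod_le_prod (fun i _ ↦ by positivity) fun i _ ↦ ?_
      have : (radixDigit M y i : ℝ) + 1 ≤ M i := by exact_mod_cast radixDigit_lt hM hy i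
      calc _ ≤ (2 * (M i : ℝ)) ^ 2 := by
            gcongr
            push_cast
            linarith
        _ = _ := by ring
    have hnext := mem_Ioc_of_eq_inv ha h0 ht (n + 1)
    have hnext' := mem_Ioc_of_eq_inv ha' h0' ht' (n + 1)
    have hterm : Δ / m / (8 * m) ≤ |t n - t' n| := by
      rw [ht n, ht' n]
      push_cast
      have hp : 0 < m + d + t (n + 1) := by linarith [hnext.1]
      have hp' : 0 < m + d' + t' (n + 1) := by linarith [hnext'.1]
      rw [inv_sub_inv hp.ne' hp'.ne', abs_div, abs_of_pos (a := _ * _) (by positivity)]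
      have hnum : Δ / 2 ≤ |m + d' + t' (n + 1) - (m + d + t (n + 1))| := by
        have h3 : |t (n + 1) - t' (n + 1)| ≤ 2⁻¹ :=
          abs_le.2 ⟨by linarith [hnext.1, hnext'.2], by linarith [hnext'.1, hnext.2]⟩
        have h4 : Δ ≤ |m + d' + t' (n + 1) - (m + d + t (n + 1))| + |t (n + 1) - t' (n + 1)| := by
          rw [abs_sub_comm (m + d' + t' (n + 1)), abs_sub_comm (t (n + 1))]
          refine le_trans (le_of_eq ?_) (abs_add_le _ _)
          change |d - d'| = _
          congr 1
          ring
        linarith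
      calc Δ / m / (8 * m) = Δ / 2 / (2 * m * (2 * m)) := by
            field_simp
            norm_num
        _ ≤ _ := by
          gcongr
          · linarith [hnext.2]
          · linarith [hnext'.2]
    calc Δ / m / (8 * 4 ^ n * m * P ^ 2) = Δ / m / (8 * m) / (4 ^ n * P ^ 2) := by
          field_simp
      _ ≤ _ := by
        gcongr
  have hρ0 : 0 < Δ / m := by positivity
  have hρ1 : Δ / m ≤ 1 := (div_le_one hm).2 hΔm
  set Q : ℝ := 8 * 4 ^ n * m * P ^ 2 with hQ
  have hQ0 : 0 < Q := by positivity
  have hC0 : 0 ≤ C := by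
    have h1 : 0 ≤ C * P := le_trans (by positivity) (hC n)
    exact nonneg_of_mul_nonneg_left h1 hP0
  calc |y - y'| ≤ 2 * (Δ / m) / P := hupper
    _ ≤ 2 * (Δ / m) ^ s / P := by
      gcongr
      exact Real.self_le_rpow_of_le_one hρ0.le hρ1 hs1
    _ ≤ C * (Δ / m / Q) ^ s := by
      rw [Real.div_rpow hρ0.le hQ0.le, ← mul_div_assoc, div_le_div_iff₀ hP0 (by positivity)]
      have h2 : 0 < (Δ / m) ^ s := by positivity
      nlinarith [hC n]
    _ ≤ C * |t 0 - t' 0| ^ s := by gcongr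

/-- If a sequence `M` does not grow too quickly, the set of points all of whose partial quotients
are bounded below by `M` has dimension at least `s`. -/
theorem le_dimH_setOf_forall_le_cfA {M : ℕ → ℕ} (hM : ∀ n, 2 ≤ M n) {s C : ℝ≥0}
    (hs0 : 0 < s) (hs1 : s ≤ 1)
    (hC : ∀ n, 2 * (8 * 4 ^ n * M n * (∏ i ∈ Finset.range n, (M i : ℝ)) ^ 2) ^ (s : ℝ) ≤
      C * ∏ i ∈ Finset.range n, (M i : ℝ)) :
    (s : ℝ≥0∞) ≤ dimH {x : ℝ | x ∈ Icc (0 : ℝ) 1 ∧ Irrational x ∧ ∀ n, M n ≤ cfA x (n + 1)} := by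
  have ha : ∀ y n, 2 ≤ M n + radixDigit M y n := fun y n ↦ (hM n).trans (Nat.le_add_right _ _)
  choose t h0 ht using fun y ↦ exists_forall_mem_Icc_and_eq_inv fun n ↦ one_le_two.trans (ha y n)
  set g : ℝ → ℝ := fun y ↦ t y 0 with hg
  have hholder : ∀ y ∈ Ico (0 : ℝ) 1, ∀ y' ∈ Ico (0 : ℝ) 1,
      |y - y'| ≤ C * |g y - g y'| ^ (s : ℝ) := by
    intro y hy y' hy'
    rcases eq_or_ne y y' with rfl | hne
    · simp only [sub_self, abs_zero]
      positivity
    · exact abs_sub_le_mul_abs_sub_rpow hM s.coe_nonneg (by exact_mod_cast hs1) hC hy hy' hne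
        (h0 y) (h0 y') (ht y) (ht y')
  have hinj : InjOn g (Ico 0 1) := by
    intro y hy y' hy' h
    have := hholder y hy y' hy'
    rw [h, sub_self, abs_zero, Real.zero_rpow (by positivity), mul_zero] at this
    exact sub_eq_zero.1 (abs_nonpos_iff.1 this)
  have hinv : HolderOnWith C s (Function.invFunOn g (Ico 0 1)) (g '' Ico 0 1) := by
    rintro _ ⟨y, hy, rfl⟩ _ ⟨y', hy', rfl⟩
    rw [hinj.leftInvOn_invFunOn hy, hinj.leftInvOn_invFunOn hy', edist_dist, edist_dist,
      ENNReal.ofReal_rpow_of_nonneg dist_nonneg s.coe_nonneg, ← ENNReal.ofReal_coe_nnreal,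
      ← ENNReal.ofReal_mul C.coe_nonneg]
    exact ENNReal.ofReal_le_ofReal (hholder y hy y' hy')
  have hdim := hinv.dimH_image_le hs0
  rw [hinj.leftInvOn_invFunOn.image_image,
    Real.dimH_of_nonempty_interior (by simp), Module.finrank_self, Nat.cast_one,
    ENNReal.le_div_iff_mul_le (by simp [hs0.ne']) (by simp), one_mul] at hdim
  refine hdim.trans ?_
  have hsub : g '' Ico 0 1 ⊆
      {x : ℝ | x ∈ Icc (0 : ℝ) 1 ∧ Irrational x ∧ ∀ n, M n ≤ cfA x (n + 1)} ∪
        range ((↑) : ℚ → ℝ) := by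
    rintro _ ⟨y, -, rfl⟩
    by_cases hi : Irrational (g y)
    · refine Or.inl ⟨h0 y 0, hi, fun n ↦ ?_⟩
      rw [hg, cfA_succ_eq_of_eq_inv (ha y) (h0 y) (ht y)]
      exact Nat.le_add_right _ _
    · exact Or.inr (not_not.1 hi)
  refine (dimH_mono hsub).trans ?_
  rw [dimH_union, dimH_countable (countable_range _)]
  simp

theorem exists_radix_bound {b c s : ℝ} (hb : 1 < b) (hc : 1 < c) (hs0 : 0 < s)
    (hs : s * (b + 1) < 1) :
    ∃ C : ℝ≥0, ∀ n : ℕ, 2 * (8 * 4 ^ n * (⌈c ^ b ^ (n + 1)⌉₊ : ℝ) *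
        (∏ i ∈ Finset.range n, (⌈c ^ b ^ (i + 1)⌉₊ : ℝ)) ^ 2) ^ s ≤
      C * ∏ i ∈ Finset.range n, (⌈c ^ b ^ (i + 1)⌉₊ : ℝ) := by
  set m : ℕ → ℝ := fun n ↦ (⌈c ^ b ^ (n + 1)⌉₊ : ℝ) with hm
  have hc1 : ∀ n : ℕ, 1 < c ^ b ^ (n + 1) := fun n ↦ Real.one_lt_rpow hc (by positivity)
  have hlogc : 0 < Real.log c := Real.log_pos hc
  have hm1 : ∀ n, c ^ b ^ (n + 1) ≤ m n := fun n ↦ Nat.le_ceil _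
  have hm0 : ∀ n, 0 < m n := fun n ↦ by linarith [hm1 n, hc1 n]
  have hlogm : ∀ n, b ^ (n + 1) * Real.log c ≤ Real.log (m n) := fun n ↦ by
    rw [← Real.log_rpow (by linarith)]
    exact Real.log_le_log (by linarith [hc1 n]) (hm1 n)
  have hlogm' : ∀ n, Real.log (m n) ≤ Real.log 2 + b ^ (n + 1) * Real.log c := fun n ↦ by
    rw [← Real.log_rpow (by linarith), ← Real.log_mul (by norm_num) (by linarith [hc1 n])]
    have := Nat.ceil_lt_add_one (a := c ^ b ^ (n + 1)) (by linarith [hc1 n])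
    exact Real.log_le_log (hm0 n) (by linarith [hc1 n])
  set L : ℕ → ℝ := fun n ↦ ∑ i ∈ Finset.range n, Real.log (m i) with hL
  have hLn : ∀ n, Real.log c * (b * ((b ^ n - 1) / (b - 1))) ≤ L n := fun n ↦ by
    rw [← geom_sum_eq hb.ne', Finset.mul_sum, Finset.mul_sum]
    refine Finset.sum_le_sum fun i _ ↦ (le_of_eq ?_).trans (hlogm i)
    ring
  have h2s : 0 < 1 - 2 * s := by nlinarith
  set ε : ℝ := Real.log c * b * ((1 - 2 * s) / (b - 1) - s) with hε
  have hε0 : 0 < ε := by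
    have : s < (1 - 2 * s) / (b - 1) := by
      rw [lt_div_iff₀ (by linarith)]
      linarith
    have := sub_pos.2 this
    positivity
  obtain ⟨K, hK⟩ :=
    bddBelow_range_of_tendsto_atTop_atTop
      (tendsto_const_mul_pow_sub_mul_atTop hb hε0 (s * Real.log 4))
  refine ⟨⟨Real.exp (Real.log 2 + s * Real.log 8 + s * Real.log 2 +
    (1 - 2 * s) * (Real.log c * (b / (b - 1))) - K), (Real.exp_pos _).le⟩, fun n ↦ ?_⟩
  have hKn : K ≤ ε * b ^ n - s * Real.log 4 * n := hK ⟨n, rfl⟩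
  have hP : ∏ i ∈ Finset.range n, m i = Real.exp (L n) := by
    rw [hL, Real.exp_sum]
    exact Finset.prod_congr rfl fun i _ ↦ (Real.exp_log (hm0 i)).symm
  have hpow : (8 * 4 ^ n * m n * Real.exp (L n) ^ 2) =
      Real.exp (Real.log 8 + n * Real.log 4 + Real.log (m n) + 2 * L n) := by
    rw [Real.exp_add, Real.exp_add, Real.exp_add, Real.exp_log (by norm_num), Real.exp_nat_mul,
      Real.exp_log (by norm_num), Real.exp_log (hm0 n), two_mul, Real.exp_add, sq]
  change 2 * (8 * 4 ^ n * m n * (∏ i ∈ Finset.range n, m i) ^ 2) ^ s ≤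
    Real.exp _ * ∏ i ∈ Finset.range n, m i
  rw [hP, hpow, ← Real.exp_mul, ← Real.exp_add]
  nth_rw 1 [← Real.exp_log (zero_lt_two' ℝ)]
  rw [← Real.exp_add, Real.exp_le_exp]
  have h1 := mul_le_mul_of_nonneg_left (hLn n) h2s.le
  have h2 := mul_le_mul_of_nonneg_left (hlogm' n) hs0.le
  have h3 : (1 - 2 * s) * (Real.log c * (b * ((b ^ n - 1) / (b - 1)))) -
      s * (b ^ (n + 1) * Real.log c) =
      ε * b ^ n - (1 - 2 * s) * (Real.log c * (b / (b - 1))) := by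
    rw [hε]
    ring
  linarith

theorem le_dimH_setOf_forall_rpow_le_cfA {b c : ℝ} (hb : 1 < b) (hc : 1 < c) :
    ENNReal.ofReal (1 / (b + 1)) ≤ dimH {x : ℝ | x ∈ Icc (0 : ℝ) 1 ∧ Irrational x ∧
      ∀ n : ℕ, 1 ≤ n → (c ^ (b ^ n) : ℝ) ≤ (cfA x n : ℝ)} := by
  refine le_of_forall_lt fun r hr ↦ ?_
  obtain ⟨s, hrs, hs⟩ := ENNReal.lt_iff_exists_nnreal_btwn.1 hr
  refine hrs.trans_le ?_
  rcases eq_zero_or_pos s with rfl | hs0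
  · simp
  rw [ENNReal.coe_lt_ofReal, lt_div_iff₀ (by linarith)] at hs
  obtain ⟨C, hC⟩ := exists_radix_bound hb hc (NNReal.coe_pos.2 hs0) hs
  have hM : ∀ n : ℕ, 2 ≤ ⌈c ^ b ^ (n + 1)⌉₊ := fun n ↦
    Nat.lt_ceil.2 (by simpa using Real.one_lt_rpow hc (by positivity))
  have hs1 : s ≤ 1 := by
    have := s.coe_nonneg
    exact_mod_cast (by nlinarith : (s : ℝ) ≤ 1)
  refine (le_dimH_setOf_forall_le_cfA hM hs0 hs1 hC).trans (dimH_mono ?_)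
  rintro x ⟨hx, hi, h⟩
  refine ⟨hx, hi, fun n hn ↦ ?_⟩
  obtain ⟨n, rfl⟩ := Nat.exists_eq_add_of_le' hn
  exact Nat.ceil_le.1 (h n)

/-- **Theorem (Łuczak; Feng–Wu–Liang–Tseng).** For reals `b, c > 1`, the set of irrational
`x ∈ [0,1]` with `a_n(x) ≥ c^{b^n}` for all `n`, and the set `E₁(φ_{b,c})` with
`φ_{b,c}(n) = c^{b^n}`, both have Hausdorff dimension `1/(b+1)`. -/
theorem luczak_theorem (b c : ℝ) (hb : 1 < b) (hc : 1 < c) :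
    dimH {x : ℝ | x ∈ Set.Icc (0 : ℝ) 1 ∧ Irrational x ∧
        ∀ n : ℕ, 1 ≤ n → (c ^ (b ^ n) : ℝ) ≤ (cfA x n : ℝ)} =
      ENNReal.ofReal (1 / (b + 1)) ∧
    dimH (E₁ (fun n => c ^ (b ^ n))) = ENNReal.ofReal (1 / (b + 1)) := by
  have hlower := le_dimH_setOf_forall_rpow_le_cfA hb hc
  have hupper := dimH_E₁_le hb hc
  have hsub : {x : ℝ | x ∈ Set.Icc (0 : ℝ) 1 ∧ Irrational x ∧
      ∀ n : ℕ, 1 ≤ n → (c ^ (b ^ n) : ℝ) ≤ (cfA x n : ℝ)} ⊆ E₁ fun n => c ^ (b ^ n) := by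
    rintro x ⟨hx, hi, h⟩
    refine ⟨⟨hx.1, hx.2.lt_of_ne hi.ne_one⟩, hi, (Set.Ici_infinite 1).mono fun n hn ↦ ⟨hn, h n hn⟩⟩
  have hmono := dimH_mono hsub
  exact ⟨le_antisymm (hmono.trans hupper) hlower, le_antisymm hupper (hlower.trans hmono)⟩
end
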